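/- Let W be a simply-laced Weyl group, π a dominant integral weight with Stab_W(π) = W_P, and let v ≤ w be π-minuscule elements such that w v^{−1} is π′-minuscule for some dominant integral weight π′. Set d = ℓ(w) − ℓ(v). Then, as rational functions, the sum over all maximal-length directed paths v = x_d →β_d x_{d−1} → ⋯ → x_1 →β_1 x_0 = w in W^P (whose edge labels β_i are simple roots) of the product (1/β_1)·(1/(β_1+β_2))·…·(1/(β_1+⋯+β_d)) equals ∏_{β ∈ S(w/v)} (1/β). -/

import Mathlib

open scoped Classical BigOperators

/-- A bundled setting for a finite crystallographic root system together with its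
Weyl group, its action on the rational span of the weight lattice, reflections,
and the data of coefficients of roots in the basis of simple roots. -/
structure WeylSetting where
  /-- index set of the Dynkin diagram (simple roots) -/
  I : Type
  [fintypeI : Fintype I]
  [decEqI : DecidableEq I]
  /-- rational span of the weight lattice -/
  V : Type
  [acg : AddCommGroup V]
  [mod : Module ℚ V]
  /-- the Weyl group -/
  W : Type
  [grp : Group W]
  /-- the action of the Weyl group on weights -/
  act : W →* (V ≃ₗ[ℚ] V)
  /-- the simple roots -/
  simple : I → V
  /-- the (finite) set of roots -/
  roots : Finset V
  /-- `coroot β μ` is the pairing `⟨μ, β∨⟩` -/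
  coroot : V → (V →ₗ[ℚ] ℚ)
  /-- the reflection `s_β ∈ W` associated to a root `β` -/
  srefl : V → W
  /-- coefficients of a positive root in the basis of simple roots -/
  posCoeff : V → I → ℕ
  simple_mem : ∀ i, simple i ∈ roots
  simple_indep : LinearIndependent ℚ simple
  roots_neg : ∀ β ∈ roots, -β ∈ roots
  root_pos_or_neg : ∀ β ∈ roots,
    (∃ c : I → ℚ, (∀ i, 0 ≤ c i) ∧ β = ∑ i, c i • simple i) ∨
    (∃ c : I → ℚ, (∀ i, 0 ≤ c i) ∧ -β = ∑ i, c i • simple i)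
  coroot_self : ∀ β ∈ roots, coroot β β = 2
  crystallographic : ∀ β ∈ roots, ∀ γ ∈ roots, ∃ n : ℤ, coroot β γ = n
  posCoeff_spec : ∀ β ∈ roots,
    (∃ c : I → ℚ, (∀ i, 0 ≤ c i) ∧ β = ∑ i, c i • simple i) →
    β = ∑ i, (posCoeff β i : ℚ) • simple i
  srefl_apply : ∀ β ∈ roots, ∀ v : V, act (srefl β) v = v - coroot β v • β
  act_faithful : ∀ g : W, (∀ v : V, act g v = v) → g = 1
  roots_invariant : ∀ g : W, ∀ β ∈ roots, act g β ∈ roots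
  coroot_equivariant : ∀ g : W, ∀ β ∈ roots, ∀ v : V,
    coroot (act g β) (act g v) = coroot β v
  generated : ∀ g : W, ∃ l : List I, g = (l.map fun i => srefl (simple i)).prod

namespace WeylSetting

attribute [instance] fintypeI decEqI acg mod grp

variable (D : WeylSetting)

/-- the simple reflection attached to a node of the Dynkin diagram -/
def s (i : D.I) : D.W := D.srefl (D.simple i)

/-- the product `s_{i_1} ⋯ s_{i_r}` of the simple reflections listed in `l` -/
def wordProd (l : List D.I) : D.W := (l.map D.s).prod

/-- `β` is a positive root: a root which is a nonnegative combination of simple roots -/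
def IsPosRoot (β : D.V) : Prop :=
  β ∈ D.roots ∧ ∃ c : D.I → ℚ, (∀ i, 0 ≤ c i) ∧ β = ∑ i, c i • D.simple i

/-- the length of a Weyl group element -/
noncomputable def length (g : D.W) : ℕ :=
  sInf {n | ∃ l : List D.I, l.length = n ∧ D.wordProd l = g}

/-- `l` is a reduced word for `g` -/
def IsReduced (l : List D.I) (g : D.W) : Prop :=
  D.wordProd l = g ∧ l.length = D.length g

/-- the number of reduced words of `g` -/
noncomputable def RedCard (g : D.W) : ℕ := Nat.card {l : List D.I // D.IsReduced l g}

/-- the (strong) Bruhat order on the Weyl group -/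
def bruhatLE : D.W → D.W → Prop :=
  Relation.ReflTransGen
    (fun a b => (∃ β, D.IsPosRoot β ∧ b = D.srefl β * a) ∧ D.length a < D.length b)

/-- strict (strong) Bruhat order -/
def bruhatLT (a b : D.W) : Prop := D.bruhatLE a b ∧ a ≠ b

/-- the left weak Bruhat order: `a ≤_L b` iff `ℓ(b a⁻¹) + ℓ(a) = ℓ(b)` -/
def weakLE (a b : D.W) : Prop := D.length (b * a⁻¹) + D.length a = D.length b

/-- the height of a positive root: the sum of its coefficients in the simple roots -/
noncomputable def ht (β : D.V) : ℕ := ∑ i, D.posCoeff β i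

/-- an integral weight: the pairings with all positive coroots are integers -/
def IsIntegral (lam : D.V) : Prop :=
  ∀ β, D.IsPosRoot β → ∃ n : ℤ, D.coroot β lam = n

/-- a dominant integral weight -/
def IsDominant (lam : D.V) : Prop :=
  D.IsIntegral lam ∧ ∀ i, 0 ≤ D.coroot (D.simple i) lam

/-- a pre-dominant integral weight: `⟨λ, β∨⟩ ≥ -1` for all positive roots `β` -/
def IsPreDominant (lam : D.V) : Prop :=
  D.IsIntegral lam ∧ ∀ β, D.IsPosRoot β → -1 ≤ D.coroot β lam

/-- the diagram `D(λ) = {β ∈ R⁺ : ⟨λ, β∨⟩ = -1}` of a pre-dominant weight -/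
noncomputable def diagram (lam : D.V) : Finset D.V :=
  D.roots.filter fun β => D.IsPosRoot β ∧ D.coroot β lam = -1

/-- `IsWeightPath λ [β₁, …, β_r]` says that
`λ = λ₀ →β₁ λ₁ →β₂ ⋯ →β_r λ_r` is a `λ`-path, i.e. each `β_j` is a positive
root, `⟨λ_{j-1}, β_j∨⟩ = -1` and `λ_j = s_{β_j}(λ_{j-1})`. -/
def IsWeightPath : D.V → List D.V → Prop
  | _, [] => True
  | lam, β :: rest =>
      D.IsPosRoot β ∧ D.coroot β lam = -1 ∧
        IsWeightPath (D.act (D.srefl β) lam) rest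

/-- the term `1/β₁ ⋅ 1/(β₁+β₂) ⋅ … ⋅ 1/(β₁+⋯+β_r)` attached to a path
`(β₁, …, β_r)`, computed in a field `F` via a linear embedding `emb`. -/
noncomputable def pathTerm {F : Type} [Field F] [Algebra ℚ F]
    (emb : D.V →ₗ[ℚ] F) (l : List D.V) : F :=
  ∏ j ∈ Finset.range l.length, (emb ((l.take (j + 1)).sum))⁻¹

/-- `w` is a π-minuscule element (in the sense of Peterson). -/
def IsMinuscule (pi : D.V) (w : D.W) : Prop :=
  ∃ l : List D.I, D.IsReduced l w ∧
    ∀ k : Fin l.length,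
      D.coroot (D.simple (l.get k)) (D.act (D.wordProd (l.drop (k.val + 1))) pi) = 1

/-- the stabilizer `W_π = Stab_W(π)` of a weight -/
def stab (pi : D.V) : Subgroup D.W where
  carrier := {g | D.act g pi = pi}
  one_mem' := by simp
  mul_mem' := by
    intro a b ha hb
    simp only [Set.mem_setOf_eq] at *
    calc D.act (a * b) pi = D.act a (D.act b pi) := by rw [map_mul]; rfl
    _ = pi := by rw [hb, ha]
  inv_mem' := by
    intro a ha
    simp only [Set.mem_setOf_eq] at *
    calc D.act a⁻¹ pi = D.act a⁻¹ (D.act a pi) := by rw [ha]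
    _ = D.act (a⁻¹ * a) pi := by rw [map_mul]; rfl
    _ = pi := by simp

/-- `u` is the minimal-length representative of its coset `uH` -/
def IsMinRep (H : Subgroup D.W) (u : D.W) : Prop :=
  ∀ g : D.W, u⁻¹ * g ∈ H → D.length u ≤ D.length g

/-- `a` and `b` lie in the same coset of `H`, i.e. `aH = bH` -/
def SameCoset (H : Subgroup D.W) (a b : D.W) : Prop := a⁻¹ * b ∈ H

/-- `u →β w` in `W^P`: `β` is a positive root, `u, w` are minimal-length
representatives, `s_β w H = u H`, and `u < w` in Bruhat order -/
def Arrow (H : Subgroup D.W) (u w : D.W) (β : D.V) : Prop :=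
  D.IsPosRoot β ∧ D.IsMinRep H u ∧ D.IsMinRep H w ∧
    D.SameCoset H (D.srefl β * w) u ∧ D.bruhatLT u w

/-- `ArrowPath H w [β₁, …, β_r]` encodes a directed path
`x_r →β_r ⋯ → x_1 →β₁ x_0 = w` in the Bruhat graph on `W^P`. -/
def ArrowPath (H : Subgroup D.W) : D.W → List D.V → Prop
  | _, [] => True
  | w, β :: rest => ∃ u, D.Arrow H u w β ∧ ArrowPath H u rest

/-- directed paths as above whose vertices all lie above `v` in Bruhat order -/
def ArrowPathGE (H : Subgroup D.W) (v : D.W) : D.W → List D.V → Prop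
  | _, [] => True
  | w, β :: rest => ∃ u, D.Arrow H u w β ∧ D.bruhatLE v u ∧ ArrowPathGE H v u rest

/-- directed paths from `u` to `w`:
`u = x_r →β_r ⋯ → x_1 →β₁ x_0 = w` encoded by the list `[β₁, …, β_r]`. -/
def ArrowPathFromTo (H : Subgroup D.W) (u : D.W) : D.W → List D.V → Prop
  | w, [] => u = w
  | w, β :: rest => ∃ x, D.Arrow H x w β ∧ ArrowPathFromTo H u x rest

/-- `S(w) = {β ∈ R⁺ : s_β w < w}` -/
noncomputable def Sset (w : D.W) : Finset D.V :=
  D.roots.filter fun β => D.IsPosRoot β ∧ D.bruhatLT (D.srefl β * w) w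

/-- `S(w/v) = {β ∈ R⁺ : v ≤ s_β w < w}` -/
noncomputable def SsetSkew (v w : D.W) : Finset D.V :=
  D.roots.filter fun β =>
    D.IsPosRoot β ∧ D.bruhatLE v (D.srefl β * w) ∧ D.bruhatLT (D.srefl β * w) w

/-- an oriented edge `x → y` in the Bruhat graph of `G/P`: `x, y` are minimal
representatives, `xH < yH`, and `yH = x s_γ H` for some positive root `γ` -/
def GEdge (H : Subgroup D.W) (x y : D.W) : Prop :=
  D.IsMinRep H x ∧ D.IsMinRep H y ∧ D.bruhatLT x y ∧
    ∃ γ, D.IsPosRoot γ ∧ D.SameCoset H (x * D.srefl γ) y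

/-- the (unique) positive root `γ` with `yH = x s_γ H` attached to an edge -/
noncomputable def edgeRoot (H : Subgroup D.W) (x y : D.W) : D.V :=
  if h : ∃ γ, D.IsPosRoot γ ∧ D.SameCoset H (x * D.srefl γ) y then h.choose else 0

/-- `GChainTo H v t [x₁, …, x_r]` encodes a directed path
`v ≤ x_r → ⋯ → x_1 → x_0 = t` in the Bruhat graph of `G/P` -/
def GChainTo (H : Subgroup D.W) (v : D.W) : D.W → List D.W → Prop
  | _, [] => True
  | t, x :: rest => D.GEdge H x t ∧ D.bruhatLE v x ∧ GChainTo H v x rest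

/-- the weighted term
`(m_Λ(x_r,x_{r-1})/W_Λ(x_r)) ⋯ (m_Λ(x_1,x_0)/W_Λ(x_1))` of a path in the
`Λ`-Bruhat graph, computed in a field `F` via a linear embedding `emb`. -/
noncomputable def chainTerm {F : Type} [Field F] [Algebra ℚ F]
    (emb : D.V →ₗ[ℚ] F) (H : Subgroup D.W) (Lam : D.W → D.V) (w : D.W) :
    D.W → List D.W → F
  | _, [] => 1
  | t, x :: rest =>
      algebraMap ℚ F (D.coroot (D.edgeRoot H x t) (Lam x)) *
        (emb (D.act x (Lam x) - D.act w (Lam x)))⁻¹ *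
        chainTerm emb H Lam w x rest

/-- the Bruhat order on cosets: `aH ≤ bH` -/
def cosetLE (H : Subgroup D.W) (a b : D.W) : Prop :=
  ∃ x y, D.SameCoset H a x ∧ D.SameCoset H b y ∧ D.bruhatLE x y

/-- the (standard) parabolic subgroup generated by simple reflections in `J` -/
def parab (J : Set D.I) : Subgroup D.W := Subgroup.closure (D.s '' J)

/-- `X*(T)_P`: integral weights orthogonal to all coroots of `W_P`,
i.e. to `γ∨` for all positive roots `γ` in the span of the simple roots of `P` -/
def OrthWeightP (J : Set D.I) (lam : D.V) : Prop :=
  D.IsIntegral lam ∧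
    ∀ γ, D.IsPosRoot γ → γ ∈ Submodule.span ℚ (D.simple '' J) → D.coroot γ lam = 0

/-- an admissible function `Λ : [v,w]^P → X*(T)_P` -/
def Admissible (J : Set D.I) (v w : D.W) (Lam : D.W → D.V) : Prop :=
  (∀ x, D.IsMinRep (D.parab J) x → D.bruhatLE v x → D.bruhatLE x w →
      D.OrthWeightP J (Lam x)) ∧
  (∀ x, D.IsMinRep (D.parab J) x → D.bruhatLE v x → D.bruhatLE x w → x ≠ w →
      D.act x (Lam x) ≠ D.act w (Lam x))

/-- the subword of `l` with letters at the positions in `S`, in increasing order -/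
def subwordF (l : List D.I) (S : Finset (Fin l.length)) : List D.I :=
  ((List.finRange l.length).filter fun j => j ∈ S).map l.get

/-- `β_j = s_{i_1} ⋯ s_{i_{j-1}}(α_{i_j})` attached to a reduced word `l` -/
noncomputable def refRoot (l : List D.I) (j : Fin l.length) : D.V :=
  D.act (D.wordProd (l.take j.val)) (D.simple (l.get j))

/-- the Weyl group is simply laced: the Cartan pairing is symmetric -/
def SimplyLaced : Prop :=
  ∀ i j, D.coroot (D.simple i) (D.simple j) = D.coroot (D.simple j) (D.simple i)

/-- generating relation of the heap order of the word `l`: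
`p_j < p_k` whenever `j < k` and `s_{i_j}`, `s_{i_k}` do not commute -/
def heapCovers (l : List D.I) (j k : Fin l.length) : Prop :=
  (j : ℕ) < (k : ℕ) ∧ D.s (l.get j) * D.s (l.get k) ≠ D.s (l.get k) * D.s (l.get j)

/-- the heap order of the word `l`: the minimal partial order generated by
`heapCovers` -/
def heapLE (l : List D.I) : Fin l.length → Fin l.length → Prop :=
  Relation.ReflTransGen (D.heapCovers l)

/-- strict heap order -/
def heapLT (l : List D.I) (j k : Fin l.length) : Prop := D.heapLE l j k ∧ j ≠ k

/-- `F` is an order filter of the heap `H(w)` of the word `l` -/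
def IsHeapFilter (l : List D.I) (F : Finset (Fin l.length)) : Prop :=
  ∀ j k, j ∈ F → D.heapLE l j k → k ∈ F

/-- `i` and `j` are joined by an edge of the Dynkin diagram -/
def adjDynkin (i j : D.I) : Prop := i ≠ j ∧ D.s i * D.s j ≠ D.s j * D.s i

/-- an elementary excitation `A ▷ B` of subsets of the heap of the word `l` -/
def Excite (l : List D.I) (A B : Finset (Fin l.length)) : Prop :=
  ∃ p q, D.heapLT l p q ∧ l.get p = l.get q ∧ q ∈ A ∧ p ∈ B ∧
    A.erase q = B.erase p ∧
    (∀ z, D.heapLT l p z → D.heapLT l z q → l.get z ≠ l.get p) ∧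
    ∀ u ∈ A, D.heapLE l p u → D.heapLE l u q → ¬ D.adjDynkin (l.get p) (l.get u)

/-- `A` is an excited diagram of `F` in the heap of the word `l`,
i.e. `A ∈ E_{H(w)}(F)` -/
def InExcited (l : List D.I) (F A : Finset (Fin l.length)) : Prop :=
  Relation.ReflTransGen (D.Excite l) F A

end WeylSetting

namespace WeylSetting
section Aux
variable {D : WeylSetting}

lemma act_mul_apply (g h : D.W) (x : D.V) : D.act (g * h) x = D.act g (D.act h x) := by
  rw [map_mul]; rfl

lemma act_one_apply (x : D.V) : D.act 1 x = x := by simp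

lemma act_inv_act (g : D.W) (x : D.V) : D.act g⁻¹ (D.act g x) = x := by
  rw [← act_mul_apply]; simp

lemma act_act_inv (g : D.W) (x : D.V) : D.act g (D.act g⁻¹ x) = x := by
  rw [← act_mul_apply]; simp

lemma eq_of_act {g h : D.W} (H : ∀ x, D.act g x = D.act h x) : g = h := by
  have : h⁻¹ * g = 1 := by
    apply D.act_faithful
    intro x
    rw [act_mul_apply, H, act_inv_act]
  rw [inv_mul_eq_one] at this
  exact this.symm

/-- the invariant symmetric form built from all coroots -/
noncomputable def bf (D : WeylSetting) : D.V →ₗ[ℚ] D.V →ₗ[ℚ] ℚ :=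
  ∑ γ ∈ D.roots, (D.coroot γ).smulRight (D.coroot γ)

lemma bf_apply (u x : D.V) : D.bf u x = ∑ γ ∈ D.roots, D.coroot γ u * D.coroot γ x := by
  simp [bf, LinearMap.sum_apply]

lemma bf_comm (u x : D.V) : D.bf u x = D.bf x u := by
  rw [bf_apply, bf_apply]
  exact Finset.sum_congr rfl fun _ _ => mul_comm _ _

lemma bf_act (g : D.W) (u x : D.V) : D.bf (D.act g u) (D.act g x) = D.bf u x := by
  symm
  rw [bf_apply, bf_apply]
  refine Finset.sum_bij (fun γ _ => D.act g γ) ?_ ?_ ?_ ?_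
  · intro a ha; exact D.roots_invariant g a ha
  · intro a _ b _ h; exact (D.act g).injective h
  · intro b hb
    exact ⟨D.act g⁻¹ b, D.roots_invariant _ b hb, act_act_inv g b⟩
  · intro a ha
    rw [D.coroot_equivariant g a ha, D.coroot_equivariant g a ha]

lemma bf_self_pos {β : D.V} (hβ : β ∈ D.roots) : 0 < D.bf β β := by
  rw [bf_apply]
  apply Finset.sum_pos'
  · intro i _; exact mul_self_nonneg _
  · exact ⟨β, hβ, by rw [D.coroot_self β hβ]; norm_num⟩

lemma srefl_self {β : D.V} (hβ : β ∈ D.roots) : D.act (D.srefl β) β = -β := by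
  rw [D.srefl_apply β hβ, D.coroot_self β hβ, two_smul]; abel

lemma coroot_mul {β : D.V} (hβ : β ∈ D.roots) (x : D.V) :
    D.coroot β x * D.bf β β = 2 * D.bf β x := by
  have h := bf_act (D.srefl β) β x
  rw [srefl_self hβ, D.srefl_apply β hβ] at h
  simp only [map_neg, map_sub, map_smul, LinearMap.neg_apply, smul_eq_mul] at h
  linarith

lemma coroot_eq {β : D.V} (hβ : β ∈ D.roots) (x : D.V) :
    D.coroot β x = 2 * D.bf β x / D.bf β β := by
  rw [eq_div_iff (bf_self_pos hβ).ne', coroot_mul hβ]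

lemma coroot_neg {β : D.V} (hβ : β ∈ D.roots) (x : D.V) :
    D.coroot (-β) x = - D.coroot β x := by
  rw [coroot_eq hβ, coroot_eq (D.roots_neg β hβ)]
  simp only [map_neg, LinearMap.neg_apply, neg_neg]
  ring

lemma coroot_act {β : D.V} (hβ : β ∈ D.roots) (g : D.W) (x : D.V) :
    D.coroot β (D.act g x) = D.coroot (D.act g⁻¹ β) x := by
  have := D.coroot_equivariant g (D.act g⁻¹ β) (D.roots_invariant _ _ hβ) x
  rw [act_act_inv] at this
  exact this

/-- if `β = c γ` then `c ⟨x, β∨⟩ = ⟨x, γ∨⟩` -/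
lemma coroot_smul {β γ : D.V} (hβ : β ∈ D.roots) (hγ : γ ∈ D.roots) {c : ℚ} (h : β = c • γ)
    (x : D.V) : c * D.coroot β x = D.coroot γ x := by
  have hB := bf_self_pos hβ
  have hG := bf_self_pos hγ
  have h1 := coroot_mul hβ x
  have h2 := coroot_mul hγ x
  rw [h] at hB h1
  simp only [map_smul, LinearMap.smul_apply, smul_eq_mul] at hB h1
  have hc : c ≠ 0 := by rintro rfl; simp at hB
  rw [← h] at h1
  have : (c * D.coroot β x - D.coroot γ x) * (c * D.bf γ γ) = 0 := by
    linear_combination h1 - c * h2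
  rcases mul_eq_zero.1 this with h3 | h3
  · linarith
  · exact absurd h3 (mul_ne_zero hc hG.ne')

lemma srefl_conj {β : D.V} (hβ : β ∈ D.roots) (g : D.W) :
    D.srefl (D.act g β) = g * D.srefl β * g⁻¹ := by
  apply eq_of_act
  intro x
  rw [D.srefl_apply _ (D.roots_invariant g β hβ), act_mul_apply, act_mul_apply,
    D.srefl_apply β hβ, map_sub, map_smul, act_act_inv, coroot_act hβ, inv_inv]

lemma srefl_smul {β γ : D.V} (hβ : β ∈ D.roots) (hγ : γ ∈ D.roots) {c : ℚ} (h : β = c • γ) :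
    D.srefl β = D.srefl γ := by
  apply eq_of_act
  intro x
  rw [D.srefl_apply _ hβ, D.srefl_apply _ hγ, ← coroot_smul hβ hγ h x]
  nth_rewrite 2 [h]
  rw [smul_smul, mul_comm]

lemma srefl_neg {β : D.V} (hβ : β ∈ D.roots) : D.srefl (-β) = D.srefl β :=
  srefl_smul (D.roots_neg β hβ) hβ (c := -1) (by simp)

lemma srefl_mul_self {β : D.V} (hβ : β ∈ D.roots) : D.srefl β * D.srefl β = 1 := by
  apply eq_of_act
  intro x
  rw [act_mul_apply, D.srefl_apply _ hβ x, map_sub, map_smul, srefl_self hβ,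
    D.srefl_apply _ hβ x]
  simp

lemma srefl_inv {β : D.V} (hβ : β ∈ D.roots) : (D.srefl β)⁻¹ = D.srefl β :=
  inv_eq_of_mul_eq_one_left (srefl_mul_self hβ)

lemma s_mul_self (i : D.I) : D.s i * D.s i = 1 := srefl_mul_self (D.simple_mem i)
lemma s_inv (i : D.I) : (D.s i)⁻¹ = D.s i := srefl_inv (D.simple_mem i)
lemma s_apply (i : D.I) (x : D.V) :
    D.act (D.s i) x = x - D.coroot (D.simple i) x • D.simple i :=
  D.srefl_apply _ (D.simple_mem i) x

lemma s_s_mul (i : D.I) (g : D.W) : D.s i * (D.s i * g) = g := by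
  rw [← mul_assoc, s_mul_self, one_mul]

/-! ### positivity -/

lemma coeff_unique {c d : D.I → ℚ} (h : ∑ i, c i • D.simple i = ∑ i, d i • D.simple i) :
    c = d := by
  have := Fintype.linearIndependent_iff.1 D.simple_indep (fun i => c i - d i)
    (by simp [sub_smul, Finset.sum_sub_distrib, h])
  funext i
  linarith [this i]

lemma simple_sum (i : D.I) : D.simple i = ∑ j, (Pi.single i (1 : ℚ) : D.I → ℚ) j • D.simple j := by
  simp [Pi.single_apply]

lemma simple_pos (i : D.I) : D.IsPosRoot (D.simple i) := by
  refine ⟨D.simple_mem i, _, ?_, simple_sum i⟩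
  intro j
  by_cases h : j = i
  · subst h; simp
  · simp [h]

lemma root_ne_zero {β : D.V} (hβ : β ∈ D.roots) : β ≠ 0 := by
  rintro rfl
  have := D.coroot_self 0 hβ
  simp at this

lemma not_pos_neg {β : D.V} (h1 : D.IsPosRoot β) (h2 : D.IsPosRoot (-β)) : False := by
  obtain ⟨hr, c, hc, h⟩ := h1
  obtain ⟨-, d, hd, h'⟩ := h2
  have : ∑ i, (c i + d i) • D.simple i = ∑ i, (0 : ℚ) • D.simple i := by
    simp only [add_smul, Finset.sum_add_distrib, ← h, ← h']; simp
  have h0 := coeff_unique (c := fun i => c i + d i) (d := fun _ => 0) this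
  apply root_ne_zero hr
  rw [h]
  apply Finset.sum_eq_zero
  intro i _
  have : c i + d i = 0 := congrFun h0 i
  have : c i = 0 := by linarith [hc i, hd i]
  rw [this, zero_smul]

lemma pos_or_neg {β : D.V} (h : β ∈ D.roots) : D.IsPosRoot β ∨ D.IsPosRoot (-β) := by
  rcases D.root_pos_or_neg β h with h1 | h1
  · exact Or.inl ⟨h, h1⟩
  · exact Or.inr ⟨D.roots_neg β h, h1⟩

lemma pos_of_not_neg {β : D.V} (h : β ∈ D.roots) (h' : ¬ D.IsPosRoot (-β)) : D.IsPosRoot β :=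
  (pos_or_neg h).resolve_right h'

lemma posCoeff_eq {β : D.V} (h : D.IsPosRoot β) :
    β = ∑ i, (D.posCoeff β i : ℚ) • D.simple i := D.posCoeff_spec β h.1 h.2

/-- the simple reflection `s_i` permutes the positive roots not proportional to `α_i` -/
lemma s_pos_or {β : D.V} (h : D.IsPosRoot β) (i : D.I) :
    D.IsPosRoot (D.act (D.s i) β) ∨
      ∃ n : ℕ, 1 ≤ n ∧ β = (n : ℚ) • D.simple i := by
  rcases pos_or_neg (D.roots_invariant (D.s i) β h.1) with h1 | h1
  · exact Or.inl h1
  · right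
    obtain ⟨-, d, hd, h2⟩ := h1
    have hb := posCoeff_eq h
    have : ∑ j, (D.coroot (D.simple i) β * (Pi.single i (1 : ℚ) : D.I → ℚ) j
        - D.posCoeff β j) • D.simple j = ∑ j, d j • D.simple j := by
      simp only [sub_smul, mul_smul, Finset.sum_sub_distrib, ← Finset.smul_sum]
      rw [← simple_sum, ← hb, ← h2, s_apply]; abel
    have h0 := coeff_unique this
    have hz : ∀ j, j ≠ i → D.posCoeff β j = 0 := by
      intro j hj
      have h3 := congrFun h0 j
      simp [hj] at h3
      have h4 : (D.posCoeff β j : ℚ) ≤ 0 := by linarith [hd j]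
      exact_mod_cast le_antisymm h4 (by positivity)
    have hb2 : β = (D.posCoeff β i : ℚ) • D.simple i := by
      conv_lhs => rw [hb]
      rw [Finset.sum_eq_single i]
      · intro j _ hj; simp [hz j hj]
      · simp
    refine ⟨D.posCoeff β i, ?_, hb2⟩
    by_contra hlt
    have : D.posCoeff β i = 0 := by omega
    rw [this] at hb2
    exact root_ne_zero h.1 (by simpa using hb2)

lemma coroot_nonneg_of_dom {pi : D.V} (hpi : ∀ i, 0 ≤ D.coroot (D.simple i) pi)
    {β : D.V} (h : D.IsPosRoot β) : 0 ≤ D.coroot β pi := by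
  rw [coroot_eq h.1]
  have hb : 0 ≤ D.bf β pi := by
    obtain ⟨-, c, hc, h2⟩ := h
    rw [h2, map_sum, LinearMap.sum_apply]
    apply Finset.sum_nonneg
    intro i _
    rw [map_smul, LinearMap.smul_apply, smul_eq_mul]
    apply mul_nonneg (hc i)
    have := coroot_mul (D.simple_mem i) pi
    have h3 := mul_nonneg (hpi i) (bf_self_pos (D.simple_mem i)).le
    linarith
  have := bf_self_pos h.1
  positivity

/-! ### length -/

lemma wordProd_nil : D.wordProd [] = 1 := rfl
lemma wordProd_cons (i : D.I) (l : List D.I) : D.wordProd (i :: l) = D.s i * D.wordProd l := by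
  simp [wordProd]

lemma exists_reduced (g : D.W) : ∃ l : List D.I, D.IsReduced l g := by
  have hne : {n | ∃ l : List D.I, l.length = n ∧ D.wordProd l = g}.Nonempty := by
    obtain ⟨l, hl⟩ := D.generated g
    exact ⟨l.length, l, rfl, hl.symm⟩
  obtain ⟨l, h1, h2⟩ := Nat.sInf_mem hne
  exact ⟨l, h2, h1⟩

lemma length_le (l : List D.I) : D.length (D.wordProd l) ≤ l.length :=
  Nat.sInf_le ⟨l, rfl, rfl⟩

lemma length_one : D.length 1 = 0 := by
  have := length_le ([] : List D.I)
  rw [wordProd_nil] at this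
  simpa using this

lemma length_s_mul_le (i : D.I) (g : D.W) : D.length (D.s i * g) ≤ D.length g + 1 := by
  obtain ⟨l, h1, h2⟩ := exists_reduced g
  rw [← h2, ← h1, ← wordProd_cons]
  exact length_le _

lemma wordProd_append (l m : List D.I) :
    D.wordProd (l ++ m) = D.wordProd l * D.wordProd m := by
  simp [wordProd]

lemma length_mul_le (g h : D.W) : D.length (g * h) ≤ D.length g + D.length h := by
  obtain ⟨l, h1, h2⟩ := exists_reduced g
  obtain ⟨m, h3, h4⟩ := exists_reduced h
  rw [← h2, ← h4, ← h1, ← h3, ← wordProd_append]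
  simpa using length_le (l ++ m)

/-- strong exchange -/
lemma strong_exchange (l : List D.I) : ∀ β : D.V, D.IsPosRoot β →
    ¬ D.IsPosRoot (D.act (D.wordProd l)⁻¹ β) →
    ∃ m : List D.I, m.length < l.length ∧ D.wordProd m = D.srefl β * D.wordProd l := by
  induction l with
  | nil =>
    intro β hβ h
    rw [wordProd_nil] at h
    simp [hβ] at h
  | cons i l ih =>
    intro β hβ h
    rcases s_pos_or hβ i with h1 | ⟨n, -, hn⟩
    · obtain ⟨m, hm, hm2⟩ := ih _ h1 (by
        rw [wordProd_cons, mul_inv_rev, s_inv, act_mul_apply] at h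
        exact h)
      refine ⟨i :: m, by simpa using hm, ?_⟩
      rw [wordProd_cons, wordProd_cons, hm2, srefl_conj hβ.1, s_inv]
      simp only [← mul_assoc, s_mul_self, one_mul]
    · refine ⟨l, by simp, ?_⟩
      rw [srefl_smul hβ.1 (D.simple_mem i) hn, wordProd_cons]
      exact (s_s_mul i _).symm

lemma length_lt_of_neg {g : D.W} {β : D.V} (hβ : D.IsPosRoot β)
    (h : ¬ D.IsPosRoot (D.act g⁻¹ β)) : D.length (D.srefl β * g) < D.length g := by
  obtain ⟨l, h1, h2⟩ := exists_reduced g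
  subst h1
  obtain ⟨m, h3, h4⟩ := strong_exchange l β hβ h
  rw [← h2, ← h4]
  exact lt_of_le_of_lt (length_le m) h3

lemma length_lt_of_pos {g : D.W} {β : D.V} (hβ : D.IsPosRoot β)
    (h : D.IsPosRoot (D.act g⁻¹ β)) : D.length g < D.length (D.srefl β * g) := by
  have := length_lt_of_neg (g := D.srefl β * g) hβ (by
    rw [mul_inv_rev, srefl_inv hβ.1, act_mul_apply, srefl_self hβ.1, map_neg]
    intro h'
    exact not_pos_neg h h')
  rwa [← mul_assoc, srefl_mul_self hβ.1, one_mul] at this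

lemma neg_iff_length {g : D.W} {β : D.V} (hβ : D.IsPosRoot β) :
    ¬ D.IsPosRoot (D.act g⁻¹ β) ↔ D.length (D.srefl β * g) < D.length g := by
  refine ⟨length_lt_of_neg hβ, fun h h' => ?_⟩
  exact absurd (length_lt_of_pos hβ h') (by omega)

lemma length_s_mul_of_neg {g : D.W} {i : D.I} (h : ¬ D.IsPosRoot (D.act g⁻¹ (D.simple i))) :
    D.length g = D.length (D.s i * g) + 1 := by
  have h1 := length_lt_of_neg (simple_pos i) h
  have h2 := length_s_mul_le i (D.s i * g)
  rw [s_s_mul] at h2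
  change D.length (D.s i * g) < _ at h1
  omega

lemma exists_descent {g : D.W} (h : g ≠ 1) : ∃ i, ¬ D.IsPosRoot (D.act g⁻¹ (D.simple i)) := by
  obtain ⟨l, h1, h2⟩ := exists_reduced g
  cases l with
  | nil => exact absurd h1.symm h
  | cons i l =>
    refine ⟨i, ?_⟩
    rw [neg_iff_length (simple_pos i)]
    change D.length (D.s i * g) < _
    rw [← h2, ← h1, wordProd_cons, s_s_mul]
    exact lt_of_le_of_lt (length_le l) (by simp)

/-! ### Bruhat order -/

lemma bruhatLE_length {a b : D.W} (h : D.bruhatLE a b) : D.length a ≤ D.length b := by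
  induction h with
  | refl => exact le_rfl
  | tail _ h ih => exact ih.trans h.2.le

lemma bruhatLT_length {a b : D.W} (h : D.bruhatLT a b) : D.length a < D.length b := by
  obtain ⟨h, hne⟩ := h
  rcases Relation.ReflTransGen.cases_tail h with h1 | ⟨c, h1, h2⟩
  · exact absurd h1.symm hne
  · exact lt_of_le_of_lt (bruhatLE_length h1) h2.2

lemma bruhat_refl_step {g : D.W} {β : D.V} (hβ : D.IsPosRoot β)
    (h : ¬ D.IsPosRoot (D.act g⁻¹ β)) : D.bruhatLE (D.srefl β * g) g := by
  refine Relation.ReflTransGen.single ⟨⟨β, hβ, ?_⟩, length_lt_of_neg hβ h⟩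
  rw [← mul_assoc, srefl_mul_self hβ.1, one_mul]

lemma bruhatLT_refl_iff {g : D.W} {β : D.V} (hβ : D.IsPosRoot β) :
    D.bruhatLT (D.srefl β * g) g ↔ ¬ D.IsPosRoot (D.act g⁻¹ β) := by
  constructor
  · intro h
    rw [neg_iff_length hβ]
    exact bruhatLT_length h
  · intro h
    refine ⟨bruhat_refl_step hβ h, fun he => ?_⟩
    have := length_lt_of_neg hβ h
    rw [he] at this
    exact lt_irrefl _ this

lemma one_bruhatLE (g : D.W) : D.bruhatLE 1 g := by
  induction hn : D.length g using Nat.strong_induction_on generalizing g with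
  | _ n ih =>
    by_cases h : g = 1
    · subst h; exact Relation.ReflTransGen.refl
    · obtain ⟨i, hi⟩ := exists_descent h
      have h1 := length_lt_of_neg (simple_pos i) hi
      exact (ih _ (hn ▸ h1) _ rfl).trans (bruhat_refl_step (simple_pos i) hi)

/-! ### minimal representatives -/

lemma mem_stab_iff {pi : D.V} {g : D.W} : g ∈ D.stab pi ↔ D.act g pi = pi := Iff.rfl

lemma sameCoset_iff {pi : D.V} {a b : D.W} :
    D.SameCoset (D.stab pi) a b ↔ D.act a pi = D.act b pi := by
  unfold SameCoset
  rw [mem_stab_iff, act_mul_apply]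
  constructor
  · intro h
    rw [← h, act_act_inv, h]
  · intro h
    rw [← h, act_inv_act]

lemma isMinRep_iff {pi : D.V} {u : D.W} :
    D.IsMinRep (D.stab pi) u ↔ ∀ g, D.act u pi = D.act g pi → D.length u ≤ D.length g :=
  forall_congr' fun _ => imp_congr sameCoset_iff Iff.rfl

/-- positivity on the roots orthogonal to `pi` -/
def ZPos (D : WeylSetting) (pi : D.V) (u : D.W) : Prop :=
  ∀ γ, D.IsPosRoot γ → D.coroot γ pi = 0 → D.IsPosRoot (D.act u γ)

lemma neg_witness {u : D.W} {γ : D.V} (hγ : D.IsPosRoot γ) {pi : D.V} (h0 : D.coroot γ pi = 0)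
    (hneg : ¬ D.IsPosRoot (D.act u γ)) :
    ∃ δ, D.IsPosRoot δ ∧ ¬ D.IsPosRoot (D.act u⁻¹ δ) ∧
      D.act (D.srefl δ * u) pi = D.act u pi := by
  have hr := D.roots_invariant u γ hγ.1
  refine ⟨-(D.act u γ), (pos_or_neg hr).resolve_left hneg, ?_, ?_⟩
  · rw [map_neg, act_inv_act]
    exact fun h => not_pos_neg hγ h
  · rw [srefl_neg hr, srefl_conj hγ.1]
    simp only [inv_mul_cancel_right]
    rw [act_mul_apply, D.srefl_apply γ hγ.1, h0]
    simp

lemma zpos_of_minRep {pi : D.V} {u : D.W} (hu : D.IsMinRep (D.stab pi) u) : D.ZPos pi u := by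
  intro γ hγ h0
  by_contra hneg
  obtain ⟨δ, hδ, h1, h2⟩ := neg_witness hγ h0 hneg
  have := isMinRep_iff.1 hu _ h2.symm
  have := length_lt_of_neg hδ h1
  omega

lemma zpos_unique {pi : D.V} (hpi : D.IsDominant pi) {u u' : D.W} (hu : D.ZPos pi u)
    (hu' : D.ZPos pi u') (h : D.act u pi = D.act u' pi) : u = u' := by
  by_contra hne
  have hp : (u⁻¹ * u')⁻¹ ≠ 1 := by
    intro h1
    rw [inv_eq_one, inv_mul_eq_one] at h1
    exact hne h1
  obtain ⟨i, hi⟩ := exists_descent hp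
  rw [inv_inv] at hi
  have hfix : D.act (u⁻¹ * u') pi = pi := by rw [act_mul_apply, ← h, act_inv_act]
  have hr := D.roots_invariant (u⁻¹ * u') _ (D.simple_mem i)
  have hγ : D.IsPosRoot (-(D.act (u⁻¹ * u') (D.simple i))) := (pos_or_neg hr).resolve_left hi
  have e1 : D.coroot (D.act (u⁻¹ * u') (D.simple i)) pi = D.coroot (D.simple i) pi := by
    have := D.coroot_equivariant (u⁻¹ * u') _ (D.simple_mem i) pi
    rwa [hfix] at this
  have e2 := coroot_nonneg_of_dom hpi.2 hγ
  rw [coroot_neg hr, e1] at e2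
  have e3 : D.coroot (D.simple i) pi = 0 := le_antisymm (by linarith) (hpi.2 i)
  have p1 := hu _ hγ (by rw [coroot_neg hr, e1, e3, neg_zero])
  have p2 := hu' _ (simple_pos i) e3
  rw [map_neg, act_mul_apply, act_act_inv] at p1
  exact not_pos_neg p2 p1

lemma minRep_unique {pi : D.V} (hpi : D.IsDominant pi) {u u' : D.W}
    (hu : D.IsMinRep (D.stab pi) u) (hu' : D.IsMinRep (D.stab pi) u')
    (h : D.act u pi = D.act u' pi) : u = u' :=
  zpos_unique hpi (zpos_of_minRep hu) (zpos_of_minRep hu') h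

lemma minRep_le {pi : D.V} (hpi : D.IsDominant pi) {v : D.W} (hv : D.IsMinRep (D.stab pi) v)
    (g : D.W) (h : D.act g pi = D.act v pi) : D.bruhatLE v g := by
  induction hn : D.length g using Nat.strong_induction_on generalizing g with
  | _ n ih =>
    by_cases hz : D.ZPos pi g
    · rw [zpos_unique hpi hz (zpos_of_minRep hv) h]
      exact Relation.ReflTransGen.refl
    · unfold ZPos at hz
      push Not at hz
      obtain ⟨γ, hγ, h0, hneg⟩ := hz
      obtain ⟨δ, hδ, h1, h2⟩ := neg_witness hγ h0 hneg
      exact (ih _ (hn ▸ length_lt_of_neg hδ h1) _ (h2.trans h) rfl).trans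
        (bruhat_refl_step hδ h1)

/-! ### weight paths -/

/-- `WP lam mu [i₁, …, i_r]`: the path of weights from `lam` up to `mu` adding the simple roots
`α_{i_1}, …, α_{i_r}`, every step being a simple reflection with pairing `-1` -/
def WP (D : WeylSetting) : D.V → D.V → List D.I → Prop
  | lam, mu, [] => lam = mu
  | lam, mu, i :: l => D.coroot (D.simple i) lam = -1 ∧ WP D (lam + D.simple i) mu l

lemma wp_nil {lam mu : D.V} : D.WP lam mu [] ↔ lam = mu := Iff.rfl
lemma wp_cons {lam mu : D.V} {i : D.I} {l : List D.I} :
    D.WP lam mu (i :: l) ↔ D.coroot (D.simple i) lam = -1 ∧ D.WP (lam + D.simple i) mu l := Iff.rfl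

lemma wp_append {l m : List D.I} : ∀ {lam mu : D.V},
    D.WP lam mu (l ++ m) ↔ ∃ nu, D.WP lam nu l ∧ D.WP nu mu m := by
  induction l with
  | nil => intro lam mu; simp [wp_nil]
  | cons i l ih =>
    intro lam mu
    rw [List.cons_append, wp_cons, ih]
    constructor
    · rintro ⟨h, nu, h1, h2⟩; exact ⟨nu, ⟨h, h1⟩, h2⟩
    · rintro ⟨nu, ⟨h, h1⟩, h2⟩; exact ⟨h, nu, h1, h2⟩

lemma wp_sum {l : List D.I} : ∀ {lam mu : D.V}, D.WP lam mu l →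
    mu = lam + (l.map D.simple).sum := by
  induction l with
  | nil => intro lam mu h; simp [wp_nil.1 h]
  | cons i l ih =>
    intro lam mu h
    rw [ih h.2]
    simp [add_assoc]

lemma wp_snoc {l : List D.I} {j : D.I} {lam mu : D.V} :
    D.WP lam mu (l ++ [j]) ↔ D.coroot (D.simple j) mu = 1 ∧ D.WP lam (mu - D.simple j) l := by
  rw [wp_append]
  constructor
  · rintro ⟨nu, h1, h2, h3⟩
    have h3 := wp_nil.1 h3
    subst h3
    refine ⟨?_, by simpa using h1⟩
    rw [map_add, h2, D.coroot_self _ (D.simple_mem j)]; norm_num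
  · rintro ⟨h1, h2⟩
    refine ⟨_, h2, ?_, ?_⟩
    · rw [map_sub, h1, D.coroot_self _ (D.simple_mem j)]; norm_num
    · rw [wp_nil]; simp

lemma sum_map_simple (l : List D.I) :
    (l.map D.simple).sum = ∑ i, (l.count i : ℚ) • D.simple i := by
  induction l with
  | nil => simp
  | cons i l ih =>
    rw [List.map_cons, List.sum_cons, ih]
    nth_rewrite 1 [simple_sum i]
    rw [← Finset.sum_add_distrib]
    refine Finset.sum_congr rfl fun j _ => ?_
    rw [← add_smul, List.count_cons]
    congr 1
    by_cases h : i = j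
    · subst h; simp [add_comm]
    · have : ¬ j = i := fun h' => h h'.symm
      simp [h, this]

lemma perm_of_sum {l m : List D.I} (h : (l.map D.simple).sum = (m.map D.simple).sum) :
    l.Perm m := by
  rw [sum_map_simple, sum_map_simple] at h
  have := coeff_unique h
  rw [List.perm_iff_count]
  intro a
  have h := congrFun this a
  simp only [Nat.cast_inj] at h
  exact h

lemma wp_self {l : List D.I} {lam : D.V} (h : D.WP lam lam l) : l = [] := by
  have h1 := wp_sum h
  have h2 : (l.map D.simple).sum = (([] : List D.I).map D.simple).sum := by
    simpa using h1.symm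
  exact List.perm_nil.1 (perm_of_sum h2)

lemma s_step {lam : D.V} {i : D.I} (h : D.coroot (D.simple i) lam = -1) :
    D.act (D.s i) lam = lam + D.simple i := by
  rw [s_apply, h]; simp

lemma srefl_step {lam β : D.V} (hβ : β ∈ D.roots) (h : D.coroot β lam = -1) :
    D.act (D.srefl β) lam = lam + β := by
  rw [D.srefl_apply β hβ, h]; simp

lemma int_all {lam : D.V} (h : D.IsIntegral lam) {β : D.V} (hβ : β ∈ D.roots) :
    ∃ n : ℤ, D.coroot β lam = n := by
  rcases pos_or_neg hβ with h1 | h1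
  · exact h β h1
  · obtain ⟨n, hn⟩ := h _ h1
    rw [coroot_neg hβ] at hn
    exact ⟨-n, by push_cast; linarith⟩

lemma int_act {lam : D.V} (h : D.IsIntegral lam) (g : D.W) : D.IsIntegral (D.act g lam) := by
  intro β hβ
  rw [coroot_act hβ.1]
  exact int_all h (D.roots_invariant _ _ hβ.1)

lemma coroot_s_act (i : D.I) {β : D.V} (hβ : β ∈ D.roots) (lam : D.V) :
    D.coroot β (D.act (D.s i) lam) = D.coroot (D.act (D.s i) β) lam := by
  rw [coroot_act hβ, s_inv]

lemma predom_step {lam : D.V} (h : D.IsPreDominant lam) {i : D.I}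
    (hi : D.coroot (D.simple i) lam = -1) : D.IsPreDominant (lam + D.simple i) := by
  rw [← s_step hi]
  refine ⟨int_act h.1 _, fun β hβ => ?_⟩
  rw [coroot_s_act i hβ.1]
  rcases s_pos_or hβ i with h1 | ⟨n, hn, h1⟩
  · exact h.2 _ h1
  · rw [← coroot_s_act i hβ.1, s_step hi]
    have h2 := coroot_smul hβ.1 (D.simple_mem i) h1 (lam + D.simple i)
    rw [map_add (D.coroot (D.simple i)), hi, D.coroot_self _ (D.simple_mem i)] at h2
    by_contra hlt
    push Not at hlt
    have : (1 : ℚ) ≤ n := by exact_mod_cast hn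
    nlinarith

lemma predom_wp {l : List D.I} : ∀ {lam mu : D.V}, D.WP lam mu l → D.IsPreDominant lam →
    D.IsPreDominant mu := by
  induction l with
  | nil => intro lam mu h hp; rwa [← wp_nil.1 h]
  | cons i l ih => intro lam mu h hp; exact ih h.2 (predom_step hp h.1)

lemma exists_simple_pos {β : D.V} (hβ : D.IsPosRoot β) :
    ∃ i, 0 < D.coroot β (D.simple i) ∧ 0 < D.coroot (D.simple i) β := by
  have h2 := D.coroot_self β hβ.1
  obtain ⟨-, c, hc, h⟩ := id hβ
  have h3 : ∑ i, c i * D.coroot β (D.simple i) = 2 := by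
    have h4 := congrArg (D.coroot β) h
    rw [h2, map_sum] at h4
    rw [h4]
    exact Finset.sum_congr rfl fun i _ => by rw [map_smul, smul_eq_mul]
  have : ∃ i ∈ Finset.univ, 0 < c i * D.coroot β (D.simple i) := by
    apply Finset.exists_lt_of_sum_lt (f := fun _ => (0 : ℚ))
    rw [h3]; simp
  obtain ⟨i, -, hi⟩ := this
  have hq : 0 < D.coroot β (D.simple i) := pos_of_mul_pos_right hi (hc i)
  refine ⟨i, hq, ?_⟩
  have hb : 0 < D.bf β (D.simple i) := by
    have := coroot_mul hβ.1 (D.simple i)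
    have h5 := mul_pos hq (bf_self_pos hβ.1)
    linarith
  rw [coroot_eq (D.simple_mem i), bf_comm]
  have := bf_self_pos (D.simple_mem i)
  positivity

lemma ht_s {β : D.V} (hβ : D.IsPosRoot β) {i : D.I} (hs : D.IsPosRoot (D.act (D.s i) β))
    (hp : 0 < D.coroot (D.simple i) β) : D.ht (D.act (D.s i) β) < D.ht β := by
  have h1 := posCoeff_eq hβ
  have h2 := posCoeff_eq hs
  have : ∑ j, (D.posCoeff (D.act (D.s i) β) j : ℚ) • D.simple j
      = ∑ j, ((D.posCoeff β j : ℚ) - D.coroot (D.simple i) β * (Pi.single i (1 : ℚ) : D.I → ℚ) j)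
        • D.simple j := by
    simp only [sub_smul, mul_smul, Finset.sum_sub_distrib, ← Finset.smul_sum]
    rw [← simple_sum, ← h1, ← h2, s_apply]
  have h3 := coeff_unique this
  unfold ht
  apply Finset.sum_lt_sum
  · intro j _
    have h4 := congrFun h3 j
    have : (D.posCoeff (D.act (D.s i) β) j : ℚ) ≤ D.posCoeff β j := by
      rw [h4]
      by_cases hj : j = i
      · subst hj; simp; exact hp.le
      · simp [hj]
    exact_mod_cast this
  · refine ⟨i, Finset.mem_univ _, ?_⟩
    have h4 := congrFun h3 i
    simp at h4
    have : (D.posCoeff (D.act (D.s i) β) i : ℚ) < D.posCoeff β i := by rw [h4]; linarith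
    exact_mod_cast this

/-- from a pre-dominant weight `lam` and a positive root with pairing `-1` one can climb from
`lam` to `lam + β` by simple steps -/
lemma reach_root (n : ℕ) : ∀ (β lam : D.V), D.IsPosRoot β → D.ht β = n → D.IsPreDominant lam →
    D.coroot β lam = -1 → ∃ l, D.WP lam (lam + β) l := by
  induction n using Nat.strong_induction_on with
  | _ n ih =>
  intro β lam hβ hn hP hb
  obtain ⟨i, hq, hp⟩ := exists_simple_pos hβ
  rcases s_pos_or hβ i with hs | ⟨m, hm, h1⟩
  · obtain ⟨p, hpz⟩ := D.crystallographic _ (D.simple_mem i) β hβ.1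
    obtain ⟨q, hqz⟩ := D.crystallographic β hβ.1 _ (D.simple_mem i)
    obtain ⟨t, ht⟩ := int_all hP.1 (D.simple_mem i)
    have hlt := ht_s hβ hs hp
    rw [hn] at hlt
    have hp0 : 0 < p := by rw [hpz] at hp; exact_mod_cast hp
    have hq0 : 0 < q := by rw [hqz] at hq; exact_mod_cast hq
    have ht1 : -1 ≤ t := by
      have := hP.2 _ (simple_pos i)
      rw [ht] at this; exact_mod_cast this
    have hsb : D.coroot (D.act (D.s i) β) lam = -1 - t * q := by
      rw [← coroot_s_act i hβ.1, s_apply, map_sub, map_smul, hb, ht, hqz, smul_eq_mul]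
    have ht0 : t ≤ 0 := by
      have := hP.2 _ hs
      rw [hsb] at this
      have h5 : t * q ≤ 0 := by
        have : (t : ℚ) * q ≤ 0 := by linarith
        exact_mod_cast this
      nlinarith
    have hsβ : D.act (D.s i) β = β - (p : ℚ) • D.simple i := by rw [s_apply, hpz]
    have h2 := D.coroot_self _ (D.simple_mem i)
    rcases (show t = 0 ∨ t = -1 by omega) with rfl | rfl
    · obtain ⟨l, hl⟩ := ih _ hlt (D.act (D.s i) β) lam hs rfl hP (by rw [hsb]; simp)
      have hP' := predom_wp hl hP
      have h6 : D.coroot (D.simple i) (lam + D.act (D.s i) β) = -p := by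
        rw [hsβ, map_add, map_sub, map_smul, ht, hpz, h2, smul_eq_mul]
        push_cast; ring
      have h7 := hP'.2 _ (simple_pos i)
      rw [h6] at h7
      have h8 : p ≤ 1 := by
        have : (p : ℚ) ≤ 1 := by linarith
        exact_mod_cast this
      have hp1 : p = 1 := by omega
      refine ⟨l ++ [i], wp_append.2 ⟨_, hl, ?_, ?_⟩⟩
      · rw [h6, hp1]; norm_num
      · rw [wp_nil, hsβ, hp1]; simp [add_assoc]
    · have ht' : D.coroot (D.simple i) lam = -1 := by rw [ht]; norm_num
      obtain ⟨l, hl⟩ := ih _ hlt (D.act (D.s i) β) (lam + D.simple i) hs rfl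
        (predom_step hP ht') (by
          rw [← s_step ht', D.coroot_equivariant _ _ hβ.1, hb])
      have hP' := predom_wp hl (predom_step hP ht')
      have h6 : D.coroot (D.simple i) (lam + D.simple i + D.act (D.s i) β) = 1 - p := by
        rw [hsβ, map_add, map_add, map_sub, map_smul, ht', hpz, h2, smul_eq_mul]
        ring
      have h7 := hP'.2 _ (simple_pos i)
      rw [h6] at h7
      have h8 : p ≤ 2 := by
        have : (p : ℚ) ≤ 2 := by linarith
        exact_mod_cast this
      rcases (show p = 1 ∨ p = 2 by omega) with rfl | rfl
      · refine ⟨i :: l, ht', ?_⟩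
        have e : lam + D.simple i + D.act (D.s i) β = lam + β := by
          rw [hsβ]; simp only [Int.cast_one, one_smul]; abel
        rwa [e] at hl
      · refine ⟨i :: (l ++ [i]), ht', wp_append.2 ⟨_, hl, ?_, ?_⟩⟩
        · rw [h6]; norm_num
        · rw [wp_nil, hsβ]
          simp only [Int.cast_ofNat, two_smul]; abel
  · have h2 := coroot_smul hβ.1 (D.simple_mem i) h1 lam
    have h3 := hP.2 _ (simple_pos i)
    rw [hb] at h2
    have hm1 : (m : ℚ) ≤ 1 := by linarith
    have : m = 1 := by
      have : m ≤ 1 := by exact_mod_cast hm1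
      omega
    subst this
    have e : β = D.simple i := by simpa using h1
    refine ⟨[i], ?_, ?_⟩
    · rw [← e]; exact hb
    · rw [wp_nil, e]

/-! ### minuscule elements -/

/-- root-theoretic form of being `pi`-minuscule -/
def PMin (D : WeylSetting) (pi : D.V) (x : D.W) : Prop :=
  ∀ γ, D.IsPosRoot γ → ¬ D.IsPosRoot (D.act x⁻¹ γ) → D.coroot γ (D.act x pi) = -1

lemma pmin_word {pi : D.V} (hpi : D.IsDominant pi) (l : List D.I)
    (h : ∀ k : Fin l.length,
      D.coroot (D.simple (l.get k)) (D.act (D.wordProd (l.drop (k.val + 1))) pi) = 1) :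
    D.PMin pi (D.wordProd l) := by
  induction l with
  | nil =>
    intro γ hγ hn
    rw [wordProd_nil] at hn
    simp [hγ] at hn
  | cons i l ih =>
    have ih := ih (fun k => by simpa using h k.succ)
    have h0 : D.coroot (D.simple i) (D.act (D.wordProd l) pi) = 1 := by
      simpa using h ⟨0, by simp⟩
    intro γ hγ hn
    rw [wordProd_cons, act_mul_apply, coroot_s_act i hγ.1]
    rcases s_pos_or hγ i with h1 | ⟨m, hm, h1⟩
    · apply ih _ h1
      rw [wordProd_cons, mul_inv_rev, s_inv, act_mul_apply] at hn
      exact hn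
    · have h2 := coroot_smul hγ.1 (D.simple_mem i) h1 (D.act (D.s i) (D.act (D.wordProd l) pi))
      rw [coroot_s_act i (D.simple_mem i), ← coroot_s_act i hγ.1] at *
      have e : D.act (D.s i) (D.simple i) = - D.simple i := srefl_self (D.simple_mem i)
      rw [e, coroot_neg (D.simple_mem i), h0] at h2
      obtain ⟨z, hz⟩ := int_all (int_act (int_act hpi.1 (D.wordProd l)) (D.s i)) hγ.1
      rw [hz] at h2 ⊢
      have h3 : (m : ℤ) * z = -1 := by exact_mod_cast h2
      have h4 : (m : ℤ) ∣ 1 := ⟨-z, by linarith⟩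
      have h5 : (m : ℤ) = 1 := Int.eq_one_of_dvd_one (by positivity) h4
      rw [h5] at h3
      have : z = -1 := by linarith
      rw [this]; norm_num

lemma pmin_of_isMinuscule {pi : D.V} (hpi : D.IsDominant pi) {x : D.W}
    (h : D.IsMinuscule pi x) : D.PMin pi x := by
  obtain ⟨l, ⟨h1, -⟩, h2⟩ := h
  rw [← h1]
  exact pmin_word hpi l h2

lemma coroot_act_nonneg {pi : D.V} (hpi : D.IsDominant pi) {x : D.W} {γ : D.V}
    (hγ : D.IsPosRoot γ) (h : D.IsPosRoot (D.act x⁻¹ γ)) : 0 ≤ D.coroot γ (D.act x pi) := by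
  rw [coroot_act hγ.1]
  exact coroot_nonneg_of_dom hpi.2 h

lemma pmin_predom {pi : D.V} (hpi : D.IsDominant pi) {x : D.W} (h : D.PMin pi x) :
    D.IsPreDominant (D.act x pi) := by
  refine ⟨int_act hpi.1 _, fun β hβ => ?_⟩
  by_cases h1 : D.IsPosRoot (D.act x⁻¹ β)
  · linarith [coroot_act_nonneg hpi hβ h1]
  · rw [h β hβ h1]

lemma neg_of_coroot {pi : D.V} (hpi : D.IsDominant pi) {x : D.W} {γ : D.V}
    (hγ : D.IsPosRoot γ) (h : D.coroot γ (D.act x pi) = -1) : ¬ D.IsPosRoot (D.act x⁻¹ γ) := by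
  intro h1
  have := coroot_act_nonneg hpi hγ h1
  rw [h] at this
  norm_num at this

lemma pmin_iff {pi : D.V} (hpi : D.IsDominant pi) {x : D.W} (h : D.PMin pi x) {γ : D.V}
    (hγ : D.IsPosRoot γ) : ¬ D.IsPosRoot (D.act x⁻¹ γ) ↔ D.coroot γ (D.act x pi) = -1 :=
  ⟨h γ hγ, neg_of_coroot hpi hγ⟩

lemma pmin_step {pi : D.V} {x : D.W} (h : D.PMin pi x) {i : D.I}
    (hi : ¬ D.IsPosRoot (D.act x⁻¹ (D.simple i))) : D.PMin pi (D.s i * x) := by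
  intro γ hγ hn
  rw [mul_inv_rev, s_inv, act_mul_apply] at hn
  rw [act_mul_apply, coroot_s_act i hγ.1]
  rcases s_pos_or hγ i with h1 | ⟨m, hm, h1⟩
  · exact h _ h1 hn
  · exfalso
    apply hn
    have e : D.act (D.s i) (D.simple i) = - D.simple i := srefl_self (D.simple_mem i)
    have hr := D.roots_invariant x⁻¹ _ (D.roots_invariant (D.s i) γ hγ.1)
    have hneg := (pos_or_neg (D.roots_invariant x⁻¹ _ (D.simple_mem i))).resolve_left hi
    obtain ⟨-, c, hc, h2⟩ := hneg
    refine ⟨hr, fun j => m * c j, fun j => mul_nonneg (by positivity) (hc j), ?_⟩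
    rw [h1, map_smul, map_smul, e, map_neg, h2, Finset.smul_sum]
    simp [mul_smul]

/-! ### Bruhat order and weight paths -/

lemma reach_of_bruhat {pi : D.V} (hpi : D.IsDominant pi) {v g : D.W} (h : D.bruhatLE v g) :
    D.IsPreDominant (D.act g pi) → ∃ l, D.WP (D.act g pi) (D.act v pi) l := by
  induction h with
  | refl => intro _; exact ⟨[], rfl⟩
  | @tail a b _ hab ih =>
    intro hP
    obtain ⟨⟨β, hβ, rfl⟩, hlen⟩ := hab
    have hpos : D.IsPosRoot (D.act a⁻¹ β) := by
      by_contra hneg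
      have := length_lt_of_neg hβ hneg
      omega
    have hm := coroot_act_nonneg hpi hβ hpos
    have e : D.act (D.srefl β * a) pi = D.act a pi - D.coroot β (D.act a pi) • β := by
      rw [act_mul_apply, D.srefl_apply β hβ.1]
    have e2 : D.coroot β (D.act (D.srefl β * a) pi) = - D.coroot β (D.act a pi) := by
      rw [e, map_sub, map_smul, D.coroot_self β hβ.1, smul_eq_mul]; ring
    have h1 := hP.2 β hβ
    rw [e2] at h1
    obtain ⟨m, hmz⟩ := int_all (int_act hpi.1 a) hβ.1
    rw [hmz] at hm h1 e e2
    have hm0 : 0 ≤ m := by exact_mod_cast hm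
    have hm1 : m ≤ 1 := by
      have : (m : ℚ) ≤ 1 := by linarith
      exact_mod_cast this
    rcases (show m = 0 ∨ m = 1 by omega) with rfl | rfl
    · have e' : D.act (D.srefl β * a) pi = D.act a pi := by simpa using e
      rw [e'] at hP ⊢
      exact ih hP
    · obtain ⟨l, hl⟩ := reach_root _ β _ hβ rfl hP (by rw [e2]; norm_num)
      have e' : D.act (D.srefl β * a) pi + β = D.act a pi := by rw [e]; simp
      rw [e'] at hl
      obtain ⟨l', hl'⟩ := ih (predom_wp hl hP)
      exact ⟨l ++ l', wp_append.2 ⟨_, hl, hl'⟩⟩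

lemma bruhat_of_reach {pi : D.V} (hpi : D.IsDominant pi) {v : D.W}
    (hv : D.IsMinRep (D.stab pi) v) (l : List D.I) :
    ∀ g : D.W, D.WP (D.act g pi) (D.act v pi) l → D.bruhatLE v g := by
  induction l with
  | nil => intro g h; exact minRep_le hpi hv g h
  | cons i l ih =>
    intro g h
    have h1 := neg_of_coroot hpi (simple_pos i) h.1
    refine (ih (D.s i * g) ?_).trans (bruhat_refl_step (simple_pos i) h1)
    rw [act_mul_apply, s_step h.1]
    exact h.2

lemma minRep_step {pi : D.V} (hpi : D.IsDominant pi) {w : D.W}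
    (hw : D.IsMinRep (D.stab pi) w) {i : D.I}
    (h : D.coroot (D.simple i) (D.act w pi) = -1) : D.IsMinRep (D.stab pi) (D.s i * w) := by
  rw [isMinRep_iff] at *
  intro g hg
  have h1 := length_s_mul_of_neg (neg_of_coroot hpi (simple_pos i) h)
  have h2 := hw (D.s i * g) (by
    rw [act_mul_apply, ← hg, ← act_mul_apply, s_s_mul])
  have h3 := length_s_mul_le i g
  omega

lemma wp_elem {pi : D.V} (hpi : D.IsDominant pi) (l : List D.I) :
    ∀ (w : D.W) (mu : D.V), D.IsMinRep (D.stab pi) w → D.WP (D.act w pi) mu l →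
    ∃ u, w = D.wordProd l * u ∧ D.IsMinRep (D.stab pi) u ∧ D.act u pi = mu ∧
      D.length w = D.length u + l.length := by
  induction l with
  | nil => intro w mu hw h; exact ⟨w, by simp [wordProd_nil], hw, h, by simp⟩
  | cons i l ih =>
    intro w mu hw h
    obtain ⟨u, h1, h2, h3, h4⟩ := ih (D.s i * w) mu (minRep_step hpi hw h.1) (by
      rw [act_mul_apply, s_step h.1]; exact h.2)
    refine ⟨u, ?_, h2, h3, ?_⟩
    · rw [wordProd_cons, mul_assoc, ← h1, s_s_mul]
    · have h5 := length_s_mul_of_neg (neg_of_coroot hpi (simple_pos i) h.1)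
      simp only [List.length_cons]
      omega

lemma arrow_char {pi : D.V} (hpi : D.IsDominant pi) {u w : D.W} {β : D.V}
    (hm : D.PMin pi w) (h : D.Arrow (D.stab pi) u w β) (hl : D.length w = D.length u + 1) :
    ∃ i, β = D.simple i ∧ u = D.s i * w ∧ D.coroot (D.simple i) (D.act w pi) = -1 := by
  obtain ⟨hβ, hu, hw, hc, hb⟩ := h
  rw [sameCoset_iff, act_mul_apply, D.srefl_apply β hβ.1] at hc
  obtain ⟨l, hwp⟩ := reach_of_bruhat hpi hb.1 (pmin_predom hpi hm)
  obtain ⟨u', h1, h2, h3, h4⟩ := wp_elem hpi l w _ hw hwp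
  have hu' := minRep_unique hpi h2 hu h3
  subst hu'
  have hl1 : l.length = 1 := by omega
  obtain ⟨i, rfl⟩ := List.length_eq_one_iff.1 hl1
  have hw1 : u' = D.s i * w := by
    rw [h1]
    simp only [wordProd, List.map_cons, List.map_nil, List.prod_cons, List.prod_nil, mul_one]
    rw [s_s_mul]
  have hs := wp_sum hwp
  have hneg := hwp.1
  refine ⟨i, ?_, hw1, hneg⟩
  obtain ⟨z, hz⟩ := int_all (int_act hpi.1 w) hβ.1
  have e1 : D.simple i = (-(z : ℚ)) • β := by
    rw [hs, hz] at hc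
    simp only [List.map_cons, List.map_nil, List.sum_cons, List.sum_nil, add_zero] at hc
    rw [neg_smul]
    have := sub_eq_iff_eq_add.1 hc
    have h7 : D.act w pi + 0 = D.act w pi + (D.simple i + (z : ℚ) • β) := by
      rw [add_zero, ← add_assoc]; exact this
    have h8 := add_left_cancel h7
    exact eq_neg_of_add_eq_zero_left h8.symm
  have e2 := coroot_smul (D.simple_mem i) hβ.1 e1 (D.act w pi)
  rw [hneg] at e2
  have hb2 := posCoeff_eq hβ
  have e3 : ∑ j, (Pi.single i (1 : ℚ) : D.I → ℚ) j • D.simple j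
      = ∑ j, (-(z : ℚ) * D.posCoeff β j) • D.simple j := by
    rw [← simple_sum]
    simp only [mul_smul, ← Finset.smul_sum]
    rw [← hb2, e1]
  have e4 := congrFun (coeff_unique e3) i
  simp only [Pi.single_eq_same] at e4
  have e5 : (1 : ℤ) = -z * D.posCoeff β i := by exact_mod_cast e4
  have hz0 : 0 < -z := by
    by_contra hc0
    push Not at hc0
    have : -z * (D.posCoeff β i : ℤ) ≤ 0 := mul_nonpos_of_nonpos_of_nonneg hc0 (by positivity)
    omega
  have e6 : -z = 1 := Int.eq_one_of_dvd_one hz0.le ⟨_, e5⟩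
  have e7 : -(z : ℚ) = 1 := by exact_mod_cast e6
  rw [e7, one_smul] at e1
  exact e1.symm

lemma arrow_of_step {pi : D.V} (hpi : D.IsDominant pi) {w : D.W}
    (hw : D.IsMinRep (D.stab pi) w) {i : D.I}
    (h : D.coroot (D.simple i) (D.act w pi) = -1) :
    D.Arrow (D.stab pi) (D.s i * w) w (D.simple i) :=
  ⟨simple_pos i, minRep_step hpi hw h, hw, sameCoset_iff.2 rfl,
    (bruhatLT_refl_iff (simple_pos i)).2 (neg_of_coroot hpi (simple_pos i) h)⟩

lemma arrowPath_length {H : Subgroup D.W} {v : D.W} (L : List D.V) :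
    ∀ w, D.ArrowPathFromTo H v w L → D.length v + L.length ≤ D.length w := by
  induction L with
  | nil => intro w h; rw [show v = w from h]; simp
  | cons β L ih =>
    rintro w ⟨x, h1, h2⟩
    have := ih x h2
    have := bruhatLT_length h1.2.2.2.2
    simp only [List.length_cons]
    omega

lemma path_iff {pi : D.V} (hpi : D.IsDominant pi) {v : D.W} (hv : D.IsMinRep (D.stab pi) v)
    (L : List D.V) : ∀ w, D.PMin pi w → D.IsMinRep (D.stab pi) w →
    ((D.ArrowPathFromTo (D.stab pi) v w L ∧ D.length w = D.length v + L.length) ↔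
      ∃ l : List D.I, L = l.map D.simple ∧ D.WP (D.act w pi) (D.act v pi) l) := by
  induction L with
  | nil =>
    intro w hm hw
    constructor
    · rintro ⟨h, -⟩
      exact ⟨[], rfl, by rw [show v = w from h]; exact rfl⟩
    · rintro ⟨l, h1, h2⟩
      have : l = [] := by simpa using h1.symm
      subst this
      have := minRep_unique hpi hw hv h2
      subst this
      exact ⟨rfl, rfl⟩
  | cons β L ih =>
    intro w hm hw
    constructor
    · rintro ⟨⟨x, h1, h2⟩, h3⟩
      have h4 := arrowPath_length L x h2
      have h5 := bruhatLT_length h1.2.2.2.2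
      simp only [List.length_cons] at h3
      obtain ⟨i, rfl, rfl, hi⟩ := arrow_char hpi hm h1 (by omega)
      obtain ⟨l, rfl, hl⟩ := (ih _ (pmin_step hm (neg_of_coroot hpi (simple_pos i) hi))
        h1.2.1).1 ⟨h2, by omega⟩
      refine ⟨i :: l, rfl, hi, ?_⟩
      rwa [act_mul_apply, s_step hi] at hl
    · rintro ⟨l, h1, h2⟩
      cases l with
      | nil => simp at h1
      | cons i l =>
        simp only [List.map_cons, List.cons.injEq] at h1
        obtain ⟨rfl, rfl⟩ := h1
        have hi := h2.1
        have hn := neg_of_coroot hpi (simple_pos i) hi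
        obtain ⟨h3, h4⟩ := (ih (D.s i * w) (pmin_step hm hn) (minRep_step hpi hw hi)).2
          ⟨l, rfl, by rw [act_mul_apply, s_step hi]; exact h2.2⟩
        refine ⟨⟨_, arrow_of_step hpi hw hi, h3⟩, ?_⟩
        have := length_s_mul_of_neg hn
        simp only [List.length_cons]
        omega

lemma mem_skew_iff {pi : D.V} (hpi : D.IsDominant pi) {v w : D.W}
    (hv : D.IsMinRep (D.stab pi) v) (hm : D.PMin pi w) (β : D.V) :
    β ∈ D.SsetSkew v w ↔ D.IsPosRoot β ∧ D.coroot β (D.act w pi) = -1 ∧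
      ∃ l, D.WP (D.act w pi + β) (D.act v pi) l := by
  unfold SsetSkew
  rw [Finset.mem_filter]
  constructor
  · rintro ⟨-, hβ, h1, h2⟩
    have h3 := hm β hβ ((bruhatLT_refl_iff hβ).1 h2)
    have e : D.act (D.srefl β * w) pi = D.act w pi + β := by
      rw [act_mul_apply, srefl_step hβ.1 h3]
    refine ⟨hβ, h3, ?_⟩
    obtain ⟨l, hl⟩ := reach_root _ β _ hβ rfl (pmin_predom hpi hm) h3
    rw [← e]
    exact reach_of_bruhat hpi h1 (by rw [e]; exact predom_wp hl (pmin_predom hpi hm))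
  · rintro ⟨hβ, h3, l, hl⟩
    have e : D.act (D.srefl β * w) pi = D.act w pi + β := by
      rw [act_mul_apply, srefl_step hβ.1 h3]
    refine ⟨hβ.1, hβ, bruhat_of_reach hpi hv l _ (by rw [e]; exact hl), ?_⟩
    exact (bruhatLT_refl_iff hβ).2 (neg_of_coroot hpi hβ h3)

/-- a reduced word of a `PMin` element is a weight path -/
lemma wp_of_reduced {pi : D.V} (k : List D.I) : ∀ x : D.W, x = D.wordProd k →
    D.length x = k.length → D.PMin pi x → D.WP (D.act x pi) pi k := by
  induction k with
  | nil => intro x hx _ _; subst hx; rw [wordProd_nil, wp_nil]; simp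
  | cons i k ih =>
    intro x hx hl hm
    have e : D.s i * x = D.wordProd k := by rw [hx, wordProd_cons, s_s_mul]
    have h1 : D.length (D.s i * x) ≤ k.length := by rw [e]; exact length_le k
    have hn : ¬ D.IsPosRoot (D.act x⁻¹ (D.simple i)) := by
      rw [neg_iff_length (simple_pos i)]
      change D.length (D.s i * x) < _
      simp only [List.length_cons] at hl
      omega
    have h2 := length_s_mul_of_neg hn
    simp only [List.length_cons] at hl
    have h3 := ih (D.s i * x) e (by omega) (pmin_step hm hn)
    have h4 := hm _ (simple_pos i) hn
    refine ⟨h4, ?_⟩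
    rwa [act_mul_apply, s_step h4] at h3

/-! ### shifting paths -/

lemma wp_shift {l : List D.I} : ∀ {lam mu : D.V} (δ : D.V),
    (∀ j ∈ l, D.coroot (D.simple j) δ = 0) → D.WP lam mu l → D.WP (lam + δ) (mu + δ) l := by
  induction l with
  | nil => intro lam mu δ _ h; rw [wp_nil.1 h, wp_nil]
  | cons i l ih =>
    intro lam mu δ hd h
    refine ⟨?_, ?_⟩
    · rw [map_add, h.1, hd i (by simp), add_zero]
    · have := ih δ (fun j hj => hd j (by simp [hj])) h.2
      rwa [add_right_comm] at this

lemma wp_diff {l : List D.I} : ∀ {lam mu lam' mu' : D.V},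
    D.WP lam mu l → D.WP lam' mu' l → ∀ j ∈ l, D.coroot (D.simple j) (lam' - lam) = 0 := by
  induction l with
  | nil => intro _ _ _ _ _ _ j hj; simp at hj
  | cons i l ih =>
    intro lam mu lam' mu' h h' j hj
    rcases List.mem_cons.1 hj with rfl | hj
    · rw [map_sub, h.1, h'.1, sub_self]
    · have := ih h.2 h'.2 j hj
      rwa [add_sub_add_right_eq_sub] at this

lemma coroot_sum_zero {l : List D.I} {δ β : D.V} (hβ : β ∈ D.roots)
    (hs : β = (l.map D.simple).sum) (hd : ∀ j ∈ l, D.coroot (D.simple j) δ = 0) :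
    D.coroot β δ = 0 := by
  rw [coroot_eq hβ]
  have : D.bf β δ = 0 := by
    rw [hs]
    clear hs
    induction l with
    | nil => simp
    | cons i l ih =>
      rw [List.map_cons, List.sum_cons, map_add, LinearMap.add_apply,
        ih (fun j hj => hd j (by simp [hj]))]
      have := coroot_mul (D.simple_mem i) δ
      rw [hd i (by simp)] at this
      linarith
  rw [this]; simp

/-! ### simply laced Cartan integers -/

lemma simple_inj : Function.Injective D.simple := D.simple_indep.injective

lemma simple_add_ne (i j : D.I) : D.simple i + D.simple j ≠ 0 := by
  intro h
  have e : -(D.simple i) = D.simple j := neg_eq_of_add_eq_zero_right h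
  exact not_pos_neg (simple_pos i) (e ▸ simple_pos j)

lemma cartan_nonpos {i j : D.I} (hij : i ≠ j) : D.coroot (D.simple i) (D.simple j) ≤ 0 := by
  rcases s_pos_or (simple_pos j) i with h | ⟨n, -, h⟩
  · obtain ⟨-, c, hc, h2⟩ := h
    rw [s_apply] at h2
    have : ∑ k, ((Pi.single j (1 : ℚ) : D.I → ℚ) k
        - D.coroot (D.simple i) (D.simple j) * (Pi.single i (1 : ℚ) : D.I → ℚ) k) • D.simple k
        = ∑ k, c k • D.simple k := by
      rw [← h2]
      simp only [sub_smul, mul_smul, Finset.sum_sub_distrib, ← Finset.smul_sum]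
      rw [← simple_sum, ← simple_sum]
    have h3 := congrFun (coeff_unique this) i
    simp [hij] at h3
    linarith [hc i]
  · exfalso
    have : ∑ k, (Pi.single j (1 : ℚ) : D.I → ℚ) k • D.simple k
        = ∑ k, ((n : ℚ) * (Pi.single i (1 : ℚ) : D.I → ℚ) k) • D.simple k := by
      simp only [mul_smul, ← Finset.smul_sum]
      rw [← simple_sum, ← simple_sum, ← h]
    have h3 := congrFun (coeff_unique this) j
    simp [hij.symm] at h3

lemma cartan_ne_neg_two {i j : D.I} (hij : D.coroot (D.simple i) (D.simple j) = -2)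
    (hji : D.coroot (D.simple j) (D.simple i) = -2) : False := by
  set x := D.simple i + D.simple j with hx
  have hi := D.coroot_self _ (D.simple_mem i)
  have hj := D.coroot_self _ (D.simple_mem j)
  have key : ∀ n : ℕ, D.simple i + (2 * n : ℚ) • x ∈ D.roots := by
    intro n
    induction n with
    | zero => simpa using D.simple_mem i
    | succ n ih =>
      have := D.roots_invariant (D.s i) _ (D.roots_invariant (D.s j) _ ih)
      have e : D.act (D.s i) (D.act (D.s j) (D.simple i + (2 * n : ℚ) • x))
          = D.simple i + (2 * (n + 1 : ℕ) : ℚ) • x := by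
        rw [s_apply j, s_apply i]
        simp only [map_add, map_sub, map_smul, hx, hi, hj, hij, hji, smul_eq_mul]
        push_cast
        module
      rwa [e] at this
  have hinj : Function.Injective (fun n : ℕ => D.simple i + (2 * n : ℚ) • x) := by
    intro a b hab
    have h1 := add_left_cancel hab
    have h2 : (2 * a : ℚ) = 2 * b := smul_left_injective ℚ (simple_add_ne i j) h1
    have : (a : ℚ) = b := by linarith
    exact_mod_cast this
  have hfin : (Set.range (fun n : ℕ => D.simple i + (2 * n : ℚ) • x)).Finite := by
    apply (D.roots.finite_toSet).subset
    rintro _ ⟨n, rfl⟩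
    exact key n
  exact Set.infinite_range_of_injective hinj hfin

lemma cartan_cases (hsl : D.SimplyLaced) {i j : D.I} (hij : i ≠ j) :
    D.coroot (D.simple i) (D.simple j) = 0 ∨ D.coroot (D.simple i) (D.simple j) = -1 := by
  have h0 := cartan_nonpos hij
  obtain ⟨a, ha⟩ := D.crystallographic _ (D.simple_mem i) _ (D.simple_mem j)
  have hs := hsl i j
  have m1 := coroot_mul (D.simple_mem i) (D.simple j)
  have m2 := coroot_mul (D.simple_mem j) (D.simple i)
  rw [bf_comm (D.simple j) (D.simple i), ← hs, ha] at m2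
  rw [ha] at m1
  have pi1 := bf_self_pos (D.simple_mem i)
  have pj1 := bf_self_pos (D.simple_mem j)
  have hnn : 0 ≤ D.bf (D.simple i + D.simple j) (D.simple i + D.simple j) := by
    rw [bf_apply]; exact Finset.sum_nonneg fun _ _ => mul_self_nonneg _
  simp only [map_add, LinearMap.add_apply] at hnn
  rw [bf_comm (D.simple j) (D.simple i)] at hnn
  rw [ha] at h0 ⊢
  have h0' : a ≤ 0 := by exact_mod_cast h0
  have hge : -2 ≤ a := by
    by_contra hlt
    push Not at hlt
    have h3 : (a : ℚ) ≤ -3 := by exact_mod_cast (by omega : a ≤ -3)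
    nlinarith
  have hne : a ≠ -2 := by
    rintro rfl
    exact cartan_ne_neg_two (i := i) (j := j) (by rw [ha]; norm_num)
      (by rw [← hs, ha]; norm_num)
  rcases (show a = 0 ∨ a = -1 by omega) with rfl | rfl
  · left; norm_num
  · right; norm_num

lemma wp_bound {i : D.I} {l : List D.I} : ∀ {lam mu : D.V}, D.WP lam mu l →
    D.coroot (D.simple i) lam ≤ 1 → D.coroot (D.simple i) mu ≤ 1 := by
  induction l with
  | nil => intro lam mu h h1; rwa [← wp_nil.1 h]
  | cons j l ih =>
    intro lam mu h h1
    apply ih h.2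
    rw [map_add]
    by_cases hij : i = j
    · subst hij
      rw [h.1, D.coroot_self _ (D.simple_mem i)]; norm_num
    · linarith [cartan_nonpos hij]

/-! ### the recursion -/

section Rec
variable {F : Type} [Field F] [Algebra ℚ F]

/-- sum over all paths of length `n` from `lam` to `mu`, by recursion on the last step -/
noncomputable def fN (e : D.V →ₗ[ℚ] F) (lam : D.V) : ℕ → D.V → F
  | 0, mu => if lam = mu then 1 else 0
  | n + 1, mu => (e (mu - lam))⁻¹ *
      ∑ j, if D.coroot (D.simple j) mu = 1 then fN e lam n (mu - D.simple j) else 0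

/-- shifted version of `fN` -/
noncomputable def fP (e : D.V →ₗ[ℚ] F) (lam : D.V) : ℕ → D.V → F
  | 0, _ => 0
  | n + 1, mu => fN e lam n mu

lemma fN_ne {e : D.V →ₗ[ℚ] F} {lam : D.V} (n : ℕ) : ∀ {mu : D.V}, fN e lam n mu ≠ 0 →
    ∃ l : List D.I, l.length = n ∧ D.WP lam mu l := by
  induction n with
  | zero =>
    intro mu h
    by_cases h1 : lam = mu
    · exact ⟨[], rfl, h1⟩
    · simp [fN, h1] at h
  | succ n ih =>
    intro mu h
    rw [fN] at h
    obtain ⟨j, -, hj⟩ := Finset.exists_ne_zero_of_sum_ne_zero (right_ne_zero_of_mul h)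
    by_cases h1 : D.coroot (D.simple j) mu = 1
    · rw [if_pos h1] at hj
      obtain ⟨l, h2, h3⟩ := ih hj
      exact ⟨l ++ [j], by simp [h2], wp_snoc.2 ⟨h1, h3⟩⟩
    · simp [h1] at hj

lemma fN_self {e : D.V →ₗ[ℚ] F} {lam : D.V} (n : ℕ) : fN e lam (n + 1) lam = 0 := by
  by_contra h
  obtain ⟨l, h1, h2⟩ := fN_ne _ h
  rw [wp_self h2] at h1
  simp at h1

lemma fN_rec {e : D.V →ₗ[ℚ] F} (he : Function.Injective e) (lam mu : D.V) (n : ℕ) :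
    e (mu - lam) * fN e lam (n + 1) mu =
      ∑ j, if D.coroot (D.simple j) mu = 1 then fN e lam n (mu - D.simple j) else 0 := by
  by_cases h : mu = lam
  · subst h
    rw [sub_self, map_zero, zero_mul]
    symm
    apply Finset.sum_eq_zero
    intro j _
    split_ifs with h1
    · by_contra h2
      obtain ⟨l, h3, h4⟩ := fN_ne _ h2
      have := wp_self (wp_snoc.2 ⟨h1, h4⟩)
      simp at this
    · rfl
  · have : e (mu - lam) ≠ 0 := by
      intro h1
      rw [← map_zero e] at h1
      exact h (sub_eq_zero.1 (he h1))
    rw [fN, mul_inv_cancel_left₀ this]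

lemma fP_rec {e : D.V →ₗ[ℚ] F} (he : Function.Injective e) (lam mu : D.V) (n : ℕ) :
    e (mu - lam) * fN e lam n mu =
      ∑ j, if D.coroot (D.simple j) mu = 1 then fP e lam n (mu - D.simple j) else 0 := by
  cases n with
  | zero =>
    simp only [fN, fP]
    by_cases h : lam = mu
    · subst h; simp
    · simp [h]
  | succ n => exact fN_rec he lam mu n

/-- twisting the embedding by a simple reflection -/
noncomputable def tw (e : D.V →ₗ[ℚ] F) (i : D.I) : D.V →ₗ[ℚ] F :=
  e.comp (D.act (D.s i)).toLinearMap

lemma tw_apply (e : D.V →ₗ[ℚ] F) (i : D.I) (x : D.V) : tw e i x = e (D.act (D.s i) x) := rfl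

lemma tw_inj {e : D.V →ₗ[ℚ] F} (he : Function.Injective e) (i : D.I) :
    Function.Injective (tw e i) := by
  intro x y h
  exact (D.act (D.s i)).injective (he h)

lemma key_term (hsl : D.SimplyLaced) {e : D.V →ₗ[ℚ] F} {lam mu : D.V} {i : D.I}
    (hP : D.IsPreDominant lam) (hi : D.coroot (D.simple i) lam ≤ 1) (n : ℕ) (j : D.I)
    {a : ℚ} (ha : D.coroot (D.simple i) mu = a) (hint : fN e lam n mu ≠ 0 →
      ∃ z : ℤ, a = z) :
    (if D.coroot (D.simple j) mu = 1 then
      (if D.coroot (D.simple i) (mu - D.simple j) = -1 then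
        fN e lam n (mu - D.simple j + D.simple i) else 0) else 0) =
    (if a = -1 then (if D.coroot (D.simple j) (mu + D.simple i) = 1 then
        fN e lam n (mu + D.simple i - D.simple j) else 0) else 0) +
      (if j = i then algebraMap ℚ F a * fN e lam n mu else 0) := by
  have hii := D.coroot_self _ (D.simple_mem i)
  have hjj := D.coroot_self _ (D.simple_mem j)
  by_cases hji : j = i
  · subst hji
    have e1 : mu - D.simple j + D.simple j = mu := by simp
    have e2 : mu + D.simple j - D.simple j = mu := by simp
    rw [e1, e2, if_pos rfl, map_sub, map_add, ha, hjj]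
    by_cases hX : fN e lam n mu = 0
    · simp [hX]
    · obtain ⟨z, hz⟩ := hint hX
      obtain ⟨l, -, hl⟩ := fN_ne _ hX
      have b1 := (predom_wp hl hP).2 _ (simple_pos j)
      have b2 := wp_bound hl hi
      rw [ha, hz] at b1 b2
      have b1' : -1 ≤ z := by exact_mod_cast b1
      have b2' : z ≤ 1 := by exact_mod_cast b2
      rcases (show z = -1 ∨ z = 0 ∨ z = 1 by omega) with rfl | rfl | rfl
      · rw [hz]; norm_num
      · rw [hz]; norm_num
      · rw [hz]; norm_num
  · have e1 : mu - D.simple j + D.simple i = mu + D.simple i - D.simple j := by abel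
    rw [e1, if_neg hji, add_zero]
    by_cases hX : fN e lam n (mu + D.simple i - D.simple j) = 0
    · simp [hX]
    obtain ⟨l, -, hl⟩ := fN_ne _ hX
    have b1 := (predom_wp hl hP).2 _ (simple_pos j)
    have b2 := wp_bound hl hi
    rw [map_sub, map_add, ha, hii] at b2
    rw [map_sub, map_add, hjj] at b1
    rw [map_sub, map_add, ha]
    have hs := hsl i j
    rcases cartan_cases hsl hji with hc | hc
    · rw [hc, add_zero, hs, hc, sub_zero]
      split_ifs <;> rfl
    · rw [hc] at hs b1
      rw [hs] at b2
      rw [hc, hs]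
      by_cases h1 : D.coroot (D.simple j) mu = 1
      · exfalso
        rw [h1] at b1
        norm_num at b1
      · rw [if_neg h1]
        by_cases h2 : a = -1
        · exfalso
          rw [h2] at b2
          norm_num at b2
        · rw [if_neg h2]

/-- recursion on the first (lowest) step -/
lemma fN_low (hsl : D.SimplyLaced) {e : D.V →ₗ[ℚ] F} (he : Function.Injective e) {lam : D.V}
    (hP : D.IsPreDominant lam) {i : D.I} (hi : D.coroot (D.simple i) lam = -1) (n : ℕ) :
    ∀ mu : D.V, e (D.simple i) * fN e lam n mu =
      fP (tw e i) (lam + D.simple i) n mu +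
      if D.coroot (D.simple i) mu = -1 then
        e (D.simple i) * fN (tw e i) (lam + D.simple i) n (mu + D.simple i) else 0 := by
  have hii := D.coroot_self _ (D.simple_mem i)
  have hP1 := predom_step hP hi
  have hb1 : D.coroot (D.simple i) (lam + D.simple i) ≤ 1 := by
    rw [map_add, hi, hii]; norm_num
  induction n with
  | zero =>
    intro mu
    simp only [fN, fP, zero_add, add_left_inj]
    by_cases h : lam = mu
    · subst h; simp [hi]
    · simp [h]
  | succ n ih =>
    intro mu
    by_cases hml : mu = lam
    · subst hml
      rw [fN_self, fN_self]
      have : fN (tw e i) (mu + D.simple i) n mu = 0 := by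
        by_contra h
        obtain ⟨l, -, h2⟩ := fN_ne _ h
        have h3 : D.WP mu mu (i :: l) := ⟨hi, h2⟩
        have := wp_self h3
        simp at this
      simp [fP, this]
    have hne : e (mu - lam) ≠ 0 := by
      intro h1
      rw [← map_zero e] at h1
      exact hml (sub_eq_zero.1 (he h1))
    apply mul_left_cancel₀ hne
    set a := D.coroot (D.simple i) mu with ha
    set lam1 := lam + D.simple i with hlam1
    have hs1 : D.act (D.s i) lam1 = lam := by
      rw [s_apply, hlam1, map_add, hi, hii]
      module
    have r1 := fP_rec (tw_inj he i) lam1 mu n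
    have t1 : tw e i (mu - lam1) = e (mu - lam) - algebraMap ℚ F a * e (D.simple i) := by
      rw [tw_apply, map_sub (D.act (D.s i)), hs1, s_apply, ← ha, map_sub, map_sub, map_sub,
        map_smul, Algebra.smul_def]
      ring
    rw [t1] at r1
    have r0 := fN_rec he lam mu n
    have r2 : a = -1 → e (mu - lam) * fN (tw e i) lam1 (n + 1) (mu + D.simple i) =
        ∑ j, if D.coroot (D.simple j) (mu + D.simple i) = 1 then
          fN (tw e i) lam1 n (mu + D.simple i - D.simple j) else 0 := by
      intro h
      have := fN_rec (tw_inj he i) lam1 (mu + D.simple i) n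
      have t2 : tw e i (mu + D.simple i - lam1) = e (mu - lam) := by
        rw [tw_apply, map_sub (D.act (D.s i)), hs1, s_apply, map_add (D.coroot (D.simple i)),
          ← ha, h, hii]
        congr 2
        module
      rwa [t2] at this
    have hint : fN (tw e i) lam1 n mu ≠ 0 → ∃ z : ℤ, a = z := by
      intro h
      obtain ⟨l, -, hl⟩ := fN_ne _ h
      exact int_all (predom_wp hl hP1).1 (D.simple_mem i)
    have hkey := Finset.sum_congr rfl fun j (_ : j ∈ Finset.univ) =>
      key_term hsl (e := tw e i) (mu := mu) hP1 hb1 n j ha.symm hint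
    rw [Finset.sum_add_distrib, Finset.sum_ite_eq' Finset.univ i] at hkey
    simp only [Finset.mem_univ, if_true] at hkey
    have hL : e (mu - lam) * (e (D.simple i) * fN e lam (n + 1) mu)
        = (∑ j, if D.coroot (D.simple j) mu = 1 then fP (tw e i) lam1 n (mu - D.simple j) else 0)
        + e (D.simple i) * (∑ j, if D.coroot (D.simple j) mu = 1 then
      (if D.coroot (D.simple i) (mu - D.simple j) = -1 then
        fN (tw e i) lam1 n (mu - D.simple j + D.simple i) else 0) else 0) := by
      rw [mul_left_comm, r0, Finset.mul_sum, Finset.mul_sum, ← Finset.sum_add_distrib]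
      refine Finset.sum_congr rfl fun j _ => ?_
      by_cases h1 : D.coroot (D.simple j) mu = 1
      · simp only [if_pos h1]
        rw [ih, mul_ite, mul_zero]
      · simp [h1]
    rw [hL, ← r1, hkey]
    have hfP : fP (tw e i) lam1 (n + 1) mu = fN (tw e i) lam1 n mu := rfl
    rw [hfP]
    by_cases h : a = -1
    · simp only [if_pos h]
      rw [← r2 h]
      ring
    · simp only [if_neg h, Finset.sum_const_zero]
      ring

lemma diagram_step {lam : D.V} (hP : D.IsPreDominant lam) {i : D.I}
    (hi : D.coroot (D.simple i) lam = -1) (e : D.V →ₗ[ℚ] F) :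
    ∏ β ∈ D.diagram lam, e β
      = e (D.simple i) * ∏ β ∈ D.diagram (lam + D.simple i), tw e i β := by
  have hii := D.coroot_self _ (D.simple_mem i)
  have hss : ∀ x, D.act (D.s i) (D.act (D.s i) x) = x := by
    intro x; rw [← act_mul_apply, s_mul_self, act_one_apply]
  have hmem : ∀ (x β : D.V), β ∈ D.diagram x ↔ D.IsPosRoot β ∧ D.coroot β x = -1 := by
    intro x β
    unfold diagram
    rw [Finset.mem_filter]
    exact ⟨fun h => h.2, fun h => ⟨h.1.1, h⟩⟩
  have hset : D.diagram lam =
      insert (D.simple i) ((D.diagram (lam + D.simple i)).image (D.act (D.s i))) := by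
    ext β
    rw [Finset.mem_insert, Finset.mem_image, hmem]
    constructor
    · rintro ⟨hβ, hb⟩
      rcases s_pos_or hβ i with h | ⟨m, hm, h⟩
      · right
        refine ⟨D.act (D.s i) β, (hmem _ _).2 ⟨h, ?_⟩, hss β⟩
        rw [← s_step hi, D.coroot_equivariant _ _ hβ.1, hb]
      · left
        have h2 := coroot_smul hβ.1 (D.simple_mem i) h lam
        rw [hb, hi] at h2
        have : (m : ℚ) = 1 := by linarith
        rw [this, one_smul] at h
        exact h
    · rintro (rfl | ⟨γ, hγ, rfl⟩)
      · exact ⟨simple_pos i, hi⟩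
      · rw [hmem] at hγ
        obtain ⟨hγ, hb⟩ := hγ
        rcases s_pos_or hγ i with h | ⟨m, hm, h⟩
        · refine ⟨h, ?_⟩
          rw [← hb, ← s_step hi, coroot_s_act i hγ.1]
        · exfalso
          have h2 := coroot_smul hγ.1 (D.simple_mem i) h (lam + D.simple i)
          rw [hb, map_add, hi, hii] at h2
          have : (1 : ℚ) ≤ m := by exact_mod_cast hm
          linarith
  rw [hset, Finset.prod_insert, Finset.prod_image]
  · rfl
  · intro x _ y _ h; exact (D.act (D.s i)).injective h
  · rw [Finset.mem_image]
    rintro ⟨γ, hγ, h⟩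
    rw [hmem] at hγ
    have h1 : γ = - D.simple i := by
      rw [← hss γ, h]
      exact srefl_self (D.simple_mem i)
    rw [h1] at hγ
    exact not_pos_neg (simple_pos i) hγ.1

lemma nakada (hsl : D.SimplyLaced) {pi : D.V} (hpi : D.IsDominant pi) (l : List D.I) :
    ∀ (lam : D.V) (e : D.V →ₗ[ℚ] F), Function.Injective e → D.IsPreDominant lam →
    D.WP lam pi l → fN e lam l.length pi * ∏ β ∈ D.diagram lam, e β = 1 := by
  induction l with
  | nil =>
    intro lam e he hP h
    have h := wp_nil.1 h
    subst h
    have : D.diagram lam = ∅ := by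
      unfold diagram
      rw [Finset.filter_eq_empty_iff]
      rintro β - ⟨h1, h2⟩
      have := coroot_nonneg_of_dom hpi.2 h1
      rw [h2] at this
      norm_num at this
    rw [this]
    simp [fN]
  | cons i l ih =>
    intro lam e he hP h
    have h1 := ih _ (tw e i) (tw_inj he i) (predom_step hP h.1) h.2
    have h2 := fN_low hsl he hP h.1 (l.length + 1) pi
    rw [if_neg (by
      intro h3
      have := hpi.2 i
      rw [h3] at this
      norm_num at this), add_zero] at h2
    rw [diagram_step hP h.1, List.length_cons, ← h1]
    change _ = fN _ _ _ _ at h2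
    rw [← h2]
    ring

lemma pathTerm_snoc (e : D.V →ₗ[ℚ] F) (L : List D.V) (x : D.V) :
    D.pathTerm e (L ++ [x]) = (e (L ++ [x]).sum)⁻¹ * D.pathTerm e L := by
  unfold pathTerm
  rw [List.length_append, List.length_singleton, Finset.prod_range_succ, mul_comm]
  congr 1
  · rw [List.take_of_length_le (by simp)]
  · refine Finset.prod_congr rfl fun j hj => ?_
    rw [Finset.mem_range] at hj
    rw [List.take_append_of_le_length (by omega)]

lemma fN_eq_sum (e : D.V →ₗ[ℚ] F) (lam : D.V) (n : ℕ) : ∀ mu : D.V,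
    (∑ t : Fin n → D.I, if D.WP lam mu (List.ofFn t) then
      D.pathTerm e ((List.ofFn t).map D.simple) else 0) = fN e lam n mu := by
  induction n with
  | zero =>
    intro mu
    simp [fN, wp_nil, pathTerm]
  | succ n ih =>
    intro mu
    rw [fN, ← (Fin.snocEquiv (fun _ : Fin (n + 1) => D.I)).sum_comp, Fintype.sum_prod_type,
      Finset.mul_sum]
    refine Finset.sum_congr rfl fun j _ => ?_
    rw [← ih, mul_ite, mul_zero, Finset.mul_sum]
    have hof : ∀ t : Fin n → D.I,
        List.ofFn ((Fin.snocEquiv (fun _ : Fin (n + 1) => D.I)) (j, t)) = List.ofFn t ++ [j] := by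
      intro t
      rw [List.ofFn_succ']
      simp [Fin.snocEquiv]
    simp only [hof]
    by_cases h : D.coroot (D.simple j) mu = 1
    · rw [if_pos h]
      refine Finset.sum_congr rfl fun t _ => ?_
      rw [mul_ite, mul_zero]
      by_cases h2 : D.WP lam (mu - D.simple j) (List.ofFn t)
      · have h3 : D.WP lam mu (List.ofFn t ++ [j]) := wp_snoc.2 ⟨h, h2⟩
        rw [if_pos h2, if_pos h3, List.map_append, List.map_singleton, pathTerm_snoc]
        have h4 := wp_sum h3
        rw [List.map_append, List.map_singleton] at h4
        congr 3
        rw [h4]; simp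
      · rw [if_neg h2, if_neg (fun h3 => h2 (wp_snoc.1 h3).2)]
    · rw [if_neg h]
      apply Finset.sum_eq_zero
      intro t _
      rw [if_neg (fun h3 => h (wp_snoc.1 h3).1)]

end Rec


/-- two weight paths with the same ends have the same labels up to order -/
lemma wp_perm {l k : List D.I} {lam mu : D.V} (h : D.WP lam mu l) (h' : D.WP lam mu k) :
    l.Perm k := by
  apply perm_of_sum
  have := (wp_sum h).symm.trans (wp_sum h')
  exact add_left_cancel this

/-- transport of weight paths along a shift killed by all labels -/
lemma wp_transfer {k : List D.I} {lam mu lam' mu' : D.V} (h : D.WP lam mu k)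
    (h' : D.WP lam' mu' k) {l : List D.I} (hl : D.WP lam mu l) : D.WP lam' mu' l := by
  have hd := wp_diff h h'
  have hp := wp_perm hl h
  have := wp_shift (lam' - lam) (fun j hj => hd j (hp.mem_iff.1 hj)) hl
  have e : mu + (lam' - lam) = mu' := by rw [wp_sum h, wp_sum h']; abel
  rwa [e, add_sub_cancel] at this

/-- transport of a root on the diagram -/
lemma root_transfer {k : List D.I} {lam mu lam' mu' : D.V} (h : D.WP lam mu k)
    (h' : D.WP lam' mu' k) (hP : D.IsPreDominant lam) {β : D.V} (hβ : D.IsPosRoot β)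
    (hb : D.coroot β lam = -1) {l : List D.I} (hl : D.WP (lam + β) mu l) :
    D.coroot β lam' = -1 ∧ D.WP (lam' + β) mu' l := by
  obtain ⟨m, hm⟩ := reach_root _ β lam hβ rfl hP hb
  have hml : D.WP lam mu (m ++ l) := wp_append.2 ⟨_, hm, hl⟩
  have hd := wp_diff hml (wp_transfer h h' hml)
  have hs : β = (m.map D.simple).sum := add_left_cancel (wp_sum hm)
  have h0 := coroot_sum_zero hβ.1 hs (fun j hj => hd j (List.mem_append_left _ hj))
  refine ⟨?_, ?_⟩
  · rw [map_sub] at h0; linarith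
  · have := wp_shift (lam' - lam) (fun j hj => hd j (List.mem_append_right _ hj)) hl
    have e : mu + (lam' - lam) = mu' := by rw [wp_sum h, wp_sum h']; abel
    have e2 : lam + β + (lam' - lam) = lam' + β := by abel
    rwa [e, e2] at this

end Aux
end WeylSetting
/-- **Skew Nakada formula, lowest-degree part (simply-laced case).** Under the
hypotheses of the skew Nakada formula, with `d = ℓ(w) - ℓ(v)`, the sum over all
maximal-length directed paths `v = x_d →β_d ⋯ →β₁ x_0 = w` in `W^P` of
`1/β₁ ⋯ 1/(β₁+⋯+β_d)` equals `∏_{β ∈ S(w/v)} 1/β`. -/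
theorem skew_nakada_maximal_paths
    (D : WeylSetting) (hsl : D.SimplyLaced)
    (pi : D.V) (hpi : D.IsDominant pi)
    (v w : D.W) (hv : D.IsMinuscule pi v) (hw : D.IsMinuscule pi w)
    (hvr : D.IsMinRep (D.stab pi) v) (hwr : D.IsMinRep (D.stab pi) w)
    (hvw : D.bruhatLE v w)
    (hmin : ∃ pi' : D.V, D.IsDominant pi' ∧ D.IsMinuscule pi' (w * v⁻¹))
    (F : Type) [Field F] [Algebra ℚ F] (emb : D.V →ₗ[ℚ] F)
    (hemb : Function.Injective emb) :
    (∑ᶠ l : List D.V,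
        if D.ArrowPathFromTo (D.stab pi) v w l ∧
            l.length = D.length w - D.length v then D.pathTerm emb l else 0) =
      ∏ β ∈ D.SsetSkew v w, (emb β)⁻¹ := by
  obtain ⟨pi', hpi', hx⟩ := hmin
  have hmw := WeylSetting.pmin_of_isMinuscule hpi hw
  have hmx := WeylSetting.pmin_of_isMinuscule hpi' hx
  have hPw := WeylSetting.pmin_predom hpi hmw
  have hPx := WeylSetting.pmin_predom hpi' hmx
  obtain ⟨k, hk⟩ := WeylSetting.reach_of_bruhat hpi hvw hPw
  obtain ⟨u, hu1, hu2, hu3, hu4⟩ := WeylSetting.wp_elem hpi k w _ hwr hk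
  obtain rfl : u = v := WeylSetting.minRep_unique hpi hu2 hvr hu3
  have hxk : w * u⁻¹ = D.wordProd k := by
    conv_lhs => rw [hu1]
    group
  have hlen : D.length (w * u⁻¹) = k.length := by
    apply le_antisymm
    · rw [hxk]; exact WeylSetting.length_le k
    · have := WeylSetting.length_mul_le (w * u⁻¹) u
      rw [inv_mul_cancel_right] at this
      omega
  have hk' := WeylSetting.wp_of_reduced k _ hxk hlen hmx
  have hS : D.SsetSkew u w = D.diagram (D.act (w * u⁻¹) pi') := by
    ext β
    rw [WeylSetting.mem_skew_iff hpi hvr hmw]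
    unfold WeylSetting.diagram
    rw [Finset.mem_filter]
    constructor
    · rintro ⟨hβ, hb, l, hl⟩
      exact ⟨hβ.1, hβ, (WeylSetting.root_transfer hk hk' hPw hβ hb hl).1⟩
    · rintro ⟨-, hβ, hb⟩
      obtain ⟨m, hm⟩ := WeylSetting.reach_root _ β _ hβ rfl hPx hb
      have hP2 := WeylSetting.predom_wp hm hPx
      have e : D.act (D.srefl β * (w * u⁻¹)) pi' = D.act (w * u⁻¹) pi' + β := by
        rw [WeylSetting.act_mul_apply, WeylSetting.srefl_step hβ.1 hb]
      rw [← e] at hP2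
      obtain ⟨l, hl⟩ := WeylSetting.reach_of_bruhat hpi' (WeylSetting.one_bruhatLE _) hP2
      rw [e, WeylSetting.act_one_apply] at hl
      obtain ⟨h1, h2⟩ := WeylSetting.root_transfer hk' hk hPx hβ hb hl
      exact ⟨hβ, h1, l, h2⟩
  have hcond : ∀ L : List D.V, (D.ArrowPathFromTo (D.stab pi) u w L ∧
      L.length = D.length w - D.length u) ↔
      ∃ l : List D.I, L = l.map D.simple ∧ D.WP (D.act (w * u⁻¹) pi') pi' l := by
    intro L
    have hle := WeylSetting.bruhatLE_length hvw
    have h1 : (L.length = D.length w - D.length u) ↔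
        D.length w = D.length u + L.length := by omega
    rw [h1, WeylSetting.path_iff hpi hvr L w hmw hwr]
    constructor
    · rintro ⟨l, h2, h3⟩
      exact ⟨l, h2, WeylSetting.wp_transfer hk hk' h3⟩
    · rintro ⟨l, h2, h3⟩
      exact ⟨l, h2, WeylSetting.wp_transfer hk' hk h3⟩
  rw [hS, Finset.prod_inv_distrib,
    ← eq_inv_of_mul_eq_one_left (WeylSetting.nakada hsl hpi' k _ emb hemb hPx hk'),
    ← WeylSetting.fN_eq_sum]
  have hinj : Function.Injective
      (fun t : Fin k.length → D.I => (List.ofFn t).map D.simple) := by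
    intro a b hab
    exact List.ofFn_injective (WeylSetting.simple_inj.list_map hab)
  rw [finsum_eq_sum_of_support_subset (s := Finset.univ.image
    (fun t : Fin k.length → D.I => (List.ofFn t).map D.simple)),
    Finset.sum_image (fun a _ b _ h => hinj h)]
  · refine Finset.sum_congr rfl fun t _ => ?_
    refine if_congr ?_ rfl rfl
    rw [hcond]
    constructor
    · rintro ⟨l, h1, h2⟩
      rwa [WeylSetting.simple_inj.list_map h1]
    · intro h
      exact ⟨_, rfl, h⟩
  · intro L hL
    rw [Function.mem_support] at hL
    have h1 := (ite_ne_right_iff.1 hL).1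
    obtain ⟨l, rfl, h2⟩ := (hcond L).1 h1
    have hlk := (WeylSetting.wp_perm h2 hk').length_eq
    rw [Finset.coe_image, Finset.coe_univ, Set.image_univ]
    refine ⟨fun j => l.get (Fin.cast hlk.symm j), ?_⟩
    congr 1
    apply List.ext_get
    · simp [hlk]
    · intro n h3 h4
      simp
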